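/- arXiv:1907.13479 — 4 statements merged into one kernel-verified Lean document; each statement's English description precedes it below -/
import Mathlib

section
/- Let v > 3 be a prime and G = PSL(2, 𝔽_v). Let F be a field of prime characteristic w with w not dividing |G|, and let W be a nonzero finite-dimensional F-vector space on which G acts linearly. Then there exists g ∈ G whose order equals v or equals (v+1)/2, and which has a nonzero fixed vector in W. -/
open scoped MatrixGroups

theorem card_sq_sub_sq_add_card_sq_sub_nonsquare_mul_sq {K : Type*} [Field K] [Fintype K]
    [DecidableEq K] (hK : ringChar K ≠ 2) {d : K} (hd : ¬ IsSquare d) (a : K) :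
    (Finset.univ.filter fun b : K => a ^ 2 - b ^ 2 = 1).card
      + (Finset.univ.filter fun b : K => a ^ 2 - d * b ^ 2 = 1).card = 2 := by
  have hd0 : d ≠ 0 := by rintro rfl; simp at hd
  have h1 := quadraticChar_card_sqrts hK (a ^ 2 - 1)
  have h2 := quadraticChar_card_sqrts hK ((a ^ 2 - 1) * d⁻¹)
  rw [map_mul, (quadraticChar_neg_one_iff_not_isSquare (a := d⁻¹)).mpr (by simpa using hd)] at h2
  have e1 : {x : K | x ^ 2 = a ^ 2 - 1}.toFinset
      = Finset.univ.filter fun b : K => a ^ 2 - b ^ 2 = 1 := by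
    ext b
    simp only [Set.mem_toFinset, Set.mem_ofPred_eq, Finset.mem_filter, Finset.mem_univ, true_and]
    constructor <;> intro h <;> linear_combination -h
  have e2 : {x : K | x ^ 2 = (a ^ 2 - 1) * d⁻¹}.toFinset
      = Finset.univ.filter fun b : K => a ^ 2 - d * b ^ 2 = 1 := by
    ext b
    simp only [Set.mem_toFinset, Set.mem_ofPred_eq, Finset.mem_filter, Finset.mem_univ, true_and,
      eq_mul_inv_iff_mul_eq₀ hd0]
    constructor <;> intro h <;> linear_combination -h
  rw [e1] at h1
  rw [e2] at h2
  omega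

theorem sum_sq_sub_sq_add_sum_sq_sub_nonsquare_mul_sq {K : Type*} [Field K] [Fintype K]
    [DecidableEq K] (hK : ringChar K ≠ 2) {d : K} (hd : ¬ IsSquare d) {E : Type*}
    [AddCommMonoid E] (f : K → E) :
    (∑ a, ∑ b, if a ^ 2 - b ^ 2 = 1 then f a else 0)
      + (∑ a, ∑ b, if a ^ 2 - d * b ^ 2 = 1 then f a else 0) = 2 • ∑ a, f a := by
  rw [← Finset.sum_add_distrib, Finset.smul_sum]
  refine Finset.sum_congr rfl fun a _ => ?_
  rw [← Finset.sum_filter, ← Finset.sum_filter, Finset.sum_const, Finset.sum_const, ← add_smul,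
    card_sq_sub_sq_add_card_sq_sub_nonsquare_mul_sq hK hd]

theorem sum_sq_sub_mul_sq_ite_eq_zero {K : Type*} [Field K] [Fintype K]
    [DecidableEq K] (hK : ringChar K ≠ 2) (d : K) {E : Type*} [AddCommMonoid E] (y : E) :
    (∑ a : K, ∑ b : K, if a ^ 2 - d * b ^ 2 = 1 then (if b = 0 then y else 0) else 0)
      = 2 • y := by
  have h : ∀ a : K, (∑ b : K, if a ^ 2 - d * b ^ 2 = 1 then (if b = 0 then y else 0) else 0)
      = if a ∈ ({1, -1} : Finset K) then y else 0 := by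
    intro a
    rw [Finset.sum_eq_single 0 (by simp +contextual) (by simp)]
    simp
  simp_rw [h]
  rw [← Finset.sum_filter, Finset.sum_const, Finset.filter_mem_eq_inter, Finset.univ_inter,
    Finset.card_pair (Ring.neg_one_ne_one_of_char_ne_two hK).symm]

theorem card_sq_sub_sq_eq_one {K : Type*} [Field K] [Fintype K]
    [DecidableEq K] (hK : ringChar K ≠ 2) :
    (∑ a : K, ∑ b : K, if a ^ 2 - b ^ 2 = 1 then 1 else 0) + 1 = Fintype.card K := by
  have h2 : (2 : K) ≠ 0 := Ring.two_ne_zero hK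
  rw [← Fintype.sum_prod_type' (f := fun a b : K => if a ^ 2 - b ^ 2 = 1 then 1 else 0),
    ← Finset.sum_filter, ← Finset.card_eq_sum_ones, Finset.card_nbij' (i := fun p => p.1 + p.2)
      (j := fun x => ((x + x⁻¹) / 2, (x - x⁻¹) / 2)) (t := Finset.univ.erase (0 : K)),
    Finset.card_erase_add_one (Finset.mem_univ _), Finset.card_univ]
  · rintro ⟨a, b⟩ h
    simp only [Finset.coe_filter, Finset.mem_univ, true_and, Set.mem_ofPred_eq] at h
    simp only [Finset.coe_erase, Finset.coe_univ, Set.mem_sdiff, Set.mem_univ, true_and,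
      Set.mem_singleton_iff]
    intro h'
    exact one_ne_zero (by linear_combination -h + (a - b) * h')
  · intro x hx
    simp only [Finset.coe_erase, Finset.coe_univ, Set.mem_sdiff, Set.mem_univ, true_and,
      Set.mem_singleton_iff] at hx
    simp only [Finset.coe_filter, Finset.mem_univ, true_and, Set.mem_ofPred_eq]
    field_simp
    ring
  · rintro ⟨a, b⟩ h
    simp only [Finset.coe_filter, Finset.mem_univ, true_and, Set.mem_ofPred_eq] at h
    have hi : (a + b)⁻¹ = a - b := inv_eq_of_mul_eq_one_right (by linear_combination h)
    simp only [hi, Prod.mk.injEq]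
    constructor <;> field_simp <;> ring
  · intro x _
    simp only
    rw [← add_div, div_eq_iff h2]
    ring

theorem card_sq_sub_nonsquare_mul_sq_eq_one {K : Type*} [Field K] [Fintype K]
    [DecidableEq K] (hK : ringChar K ≠ 2) {d : K} (hd : ¬ IsSquare d) :
    (∑ a : K, ∑ b : K, if a ^ 2 - d * b ^ 2 = 1 then 1 else 0) = Fintype.card K + 1 := by
  have h := sum_sq_sub_sq_add_sum_sq_sub_nonsquare_mul_sq hK hd (fun _ => (1 : ℕ))
  have h' := card_sq_sub_sq_eq_one hK
  simp only [Finset.sum_const, Finset.card_univ, smul_eq_mul, mul_one] at h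
  omega

theorem sum_comp_mul_right_of_ne_zero {K : Type*} [Field K] [Fintype K] {E : Type*}
    [AddCommMonoid E] (f : K → E) {c : K} (hc : c ≠ 0) : ∑ x, f (x * c) = ∑ x, f x :=
  Equiv.sum_comp (Equiv.mulRight₀ c hc) f

section ConjugateSums

variable {K : Type*} [Field K] [Fintype K] {E : Type*} [Ring E]

/-- The sum of the values of `r` at the conjugates of `M` by the upper unitriangular matrices. -/
def unipotentConjSum (r : Matrix (Fin 2) (Fin 2) K → E) (M : Matrix (Fin 2) (Fin 2) K) : E :=
  ∑ x, r (!![1, x; 0, 1] * M * !![1, -x; 0, 1])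

theorem unipotentConjSum_eq_of_conj (r : Matrix (Fin 2) (Fin 2) K → E)
    (M : Matrix (Fin 2) (Fin 2) K) (y : K) :
    unipotentConjSum r (!![1, y; 0, 1] * M * !![1, -y; 0, 1]) = unipotentConjSum r M := by
  unfold unipotentConjSum
  rw [← Equiv.sum_comp (Equiv.addRight y) fun x => r (!![1, x; 0, 1] * M * !![1, -x; 0, 1])]
  refine Finset.sum_congr rfl fun x _ => congrArg r ?_
  have h : ∀ s t : K, (!![1, s; 0, 1] * !![1, t; 0, 1] : Matrix (Fin 2) (Fin 2) K)
      = !![1, s + t; 0, 1] := by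
    intro s t
    simp [add_comm]
  simp only [Equiv.coe_addRight]
  rw [← h x y, neg_add, add_comm (-x), ← h (-y) (-x)]
  simp only [mul_assoc]

theorem unipotentConjSum_eq_of_det_eq_one (r : Matrix (Fin 2) (Fin 2) K → E) {a b c d : K}
    (hc : c ≠ 0) (h : a * d - b * c = 1) :
    unipotentConjSum r !![a, b; c, d] = unipotentConjSum r !![a + d, -c⁻¹; c, 0] := by
  rw [← unipotentConjSum_eq_of_conj r !![a + d, -c⁻¹; c, 0] (-d / c)]
  congr 1
  have hb : b = (a * d - 1) / c := by
    field_simp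
    linear_combination -h
  subst hb
  ext i j
  fin_cases i <;> fin_cases j <;> simp [Matrix.mul_apply, Fin.sum_univ_two] <;> field_simp <;> ring

/-- The sum of `unipotentConjSum` over the classes of matrices of determinant one and trace `τ`
that are not upper triangular. -/
def bigCellTraceSum [DecidableEq K] (r : Matrix (Fin 2) (Fin 2) K → E) (τ : K) : E :=
  ∑ c ∈ Finset.univ.erase (0 : K), unipotentConjSum r !![τ, -c⁻¹; c, 0]

variable [DecidableEq K] {r : Matrix (Fin 2) (Fin 2) K → E}
  (hmul : ∀ M N, M.det = 1 → N.det = 1 → r (M * N) = r M * r N)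
include hmul

theorem sum_bigCellTraceSum (hU : ∑ x, r !![1, x; 0, 1] = 0) :
    ∑ τ, bigCellTraceSum r τ = 0 := by
  unfold bigCellTraceSum unipotentConjSum
  rw [Finset.sum_comm]
  refine Finset.sum_eq_zero fun c hc => ?_
  have hc : c ≠ 0 := Finset.ne_of_mem_erase hc
  rw [Finset.sum_comm]
  refine Finset.sum_eq_zero fun x _ => ?_
  have h : ∀ τ : K, r (!![1, x; 0, 1] * !![τ, -c⁻¹; c, 0] * !![1, -x; 0, 1])
      = r !![1, x + τ / c; 0, 1] * r (!![0, -c⁻¹; c, 0] * !![1, -x; 0, 1]) := by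
    intro τ
    rw [← hmul _ _ (by simp) (by simp [Matrix.det_fin_two, hc])]
    congr 1
    ext i j
    fin_cases i <;> fin_cases j <;> simp [Matrix.mul_apply, Fin.sum_univ_two] <;> field_simp
      <;> ring
  simp_rw [h]
  rw [← Finset.sum_mul, ← Equiv.sum_comp ((Equiv.addLeft (-x)).trans (Equiv.mulRight₀ c hc))]
  simp [hc, hU]

theorem bigCellTraceSum_add_inv (hL : ∑ x, r !![1, 0; x, 1] = 0) {l : K} (hl : l ≠ 0) :
    bigCellTraceSum r (l⁻¹ + l) = -unipotentConjSum r !![l⁻¹, 0; 0, l] := by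
  have h : ∑ c, unipotentConjSum r !![l⁻¹, 0; c, l] = 0 := by
    unfold unipotentConjSum
    rw [Finset.sum_comm]
    refine Finset.sum_eq_zero fun x _ => ?_
    have h : ∀ c : K, r (!![1, x; 0, 1] * !![l⁻¹, 0; c, l] * !![1, -x; 0, 1])
        = r !![1, x; 0, 1] * r !![1, 0; c * l, 1]
          * r (!![l⁻¹, 0; 0, l] * !![1, -x; 0, 1]) := by
      intro c
      rw [← hmul _ _ (by simp) (by simp), ← hmul _ _ (by simp [Matrix.det_fin_two])
        (by simp [Matrix.det_fin_two, hl])]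
      congr 1
      ext i j
      fin_cases i <;> fin_cases j <;> simp [Matrix.mul_apply, Fin.sum_univ_two] <;> field_simp
    simp_rw [h]
    rw [← Finset.sum_mul, ← Finset.mul_sum,
      sum_comp_mul_right_of_ne_zero (fun x => r !![1, 0; x, 1]) hl, hL, mul_zero, zero_mul]
  rw [← Finset.sum_erase_add _ _ (Finset.mem_univ 0)] at h
  rw [← eq_neg_iff_add_eq_zero.mpr h]
  refine Finset.sum_congr rfl fun c hc => ?_
  exact (unipotentConjSum_eq_of_det_eq_one r (Finset.ne_of_mem_erase hc) (by simp [hl])).symm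

omit [DecidableEq K] in
theorem unipotentConjSum_diagonal (hU : ∑ x, r !![1, x; 0, 1] = 0) {l : K} (hl : l ≠ 0)
    (hl' : l ^ 2 ≠ 1) : unipotentConjSum r !![l⁻¹, 0; 0, l] = 0 := by
  unfold unipotentConjSum
  have h : ∀ x : K, r (!![1, x; 0, 1] * !![l⁻¹, 0; 0, l] * !![1, -x; 0, 1])
      = r !![l⁻¹, 0; 0, l] * r !![1, x * (l ^ 2 - 1); 0, 1] := by
    intro x
    rw [← hmul _ _ (by simp [Matrix.det_fin_two, hl]) (by simp)]
    congr 1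
    ext i j
    fin_cases i <;> fin_cases j <;> simp [Matrix.mul_apply, Fin.sum_univ_two] <;>
      field_simp
    ring
  simp_rw [h]
  rw [← Finset.mul_sum, sum_comp_mul_right_of_ne_zero (fun x => r !![1, x; 0, 1])
    (sub_ne_zero.mpr hl'), hU, mul_zero]

omit [DecidableEq K] hmul in
theorem unipotentConjSum_diagonal_of_sq_eq_one (h1 : r 1 = 1) (hneg : r (-1) = 1) {a : K}
    (ha : a ^ 2 = 1) : unipotentConjSum r !![a, 0; 0, a] = Fintype.card K := by
  have hu : ∀ x : K, (!![1, x; 0, 1] * !![1, -x; 0, 1] : Matrix (Fin 2) (Fin 2) K) = 1 := by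
    intro x
    simp [Matrix.one_fin_two]
  have hr : r (a • 1) = 1 := by
    rcases sq_eq_one_iff.mp ha with rfl | rfl <;> simpa
  have hM : (!![a, 0; 0, a] : Matrix (Fin 2) (Fin 2) K) = a • 1 := by
    simp [Matrix.one_fin_two]
  unfold unipotentConjSum
  simp only [hM, mul_smul_comm, mul_one, smul_mul_assoc, hu, hr, Finset.sum_const,
    Finset.card_univ, nsmul_eq_mul]

/-- If `r` is multiplicative on matrices of determinant one, trivial on `-1`, and sums to zero on
both unitriangular subgroups and on all tori `a ^ 2 - d * b ^ 2 = 1` with `d` a nonsquare, then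
`2 * q * (q + 1)` vanishes in the target. -/
theorem two_mul_card_mul_card_add_one_eq_zero (hK : ringChar K ≠ 2) {d : K} (hd : ¬ IsSquare d)
    (h1 : r 1 = 1) (hneg : r (-1) = 1)
    (hU : ∑ x, r !![1, x; 0, 1] = 0) (hL : ∑ x, r !![1, 0; x, 1] = 0)
    (hC : ∀ s : K, s ≠ 0 →
      (∑ a, ∑ b, if a ^ 2 - d * b ^ 2 = 1 then r !![a, d * b * s⁻¹; s * b, a] else 0) = 0) :
    ((2 * Fintype.card K * (Fintype.card K + 1) : ℕ) : E) = 0 := by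
  have h2 : (2 : K) ≠ 0 := Ring.two_ne_zero hK
  set q : ℕ := Fintype.card K with hq
  have hsplit : ∀ a b : K, a ^ 2 - b ^ 2 = 1 →
      bigCellTraceSum r (a * 2) = if b = 0 then -(q : E) else 0 := by
    intro a b hab
    have hinv : (a + b)⁻¹ = a - b := inv_eq_of_mul_eq_one_right (by linear_combination hab)
    have hl : a + b ≠ 0 := by
      intro h
      exact one_ne_zero (by linear_combination -hab + (a - b) * h)
    have := bigCellTraceSum_add_inv hmul hL hl
    rw [hinv, show a - b + (a + b) = a * 2 by ring] at this
    rw [this]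
    split_ifs with hb
    · subst hb
      rw [sub_zero, add_zero,
        unipotentConjSum_diagonal_of_sq_eq_one h1 hneg (by linear_combination hab)]
    · rw [← hinv, unipotentConjSum_diagonal hmul hU hl, neg_zero]
      intro h
      have : 2 * b * (a + b) = 0 := by linear_combination h - hab
      simp_all
  have hnonsplit : ∀ a b : K, a ^ 2 - d * b ^ 2 = 1 →
      bigCellTraceSum r (a * 2)
        = (∑ s ∈ Finset.univ.erase (0 : K), unipotentConjSum r !![a, d * b * s⁻¹; s * b, a])
          - if b = 0 then (q ^ 2 : E) else 0 := by
    intro a b hab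
    split_ifs with hb
    · subst hb
      have ha : a ^ 2 = 1 := by linear_combination hab
      rw [hsplit a 0 (by linear_combination hab), if_pos rfl]
      simp only [mul_zero, zero_mul]
      rw [unipotentConjSum_diagonal_of_sq_eq_one h1 hneg ha, Finset.sum_const, eq_sub_iff_add_eq,
        ← add_left_inj (q : E), add_assoc, ← succ_nsmul,
        Finset.card_erase_add_one (Finset.mem_univ _), Finset.card_univ, ← hq, nsmul_eq_mul]
      noncomm_ring
    · rw [sub_zero]
      have : ∀ s ∈ Finset.univ.erase (0 : K), unipotentConjSum r !![a, d * b * s⁻¹; s * b, a]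
          = unipotentConjSum r !![a * 2, -(s * b)⁻¹; s * b, 0] := by
        intro s hs
        have hs : s ≠ 0 := Finset.ne_of_mem_erase hs
        rw [unipotentConjSum_eq_of_det_eq_one r (mul_ne_zero hs hb), mul_two]
        field_simp
        linear_combination hab
      rw [Finset.sum_congr rfl this]
      unfold bigCellTraceSum
      symm
      refine Finset.sum_equiv (Equiv.mulRight₀ b hb) (by simp [hb]) (by simp)
  have hzero : (∑ a : K, ∑ b : K, if a ^ 2 - d * b ^ 2 = 1 then
      (∑ s ∈ Finset.univ.erase (0 : K), unipotentConjSum r !![a, d * b * s⁻¹; s * b, a])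
        else 0) = 0 := by
    have : ∀ s ∈ Finset.univ.erase (0 : K), (∑ a : K, ∑ b : K, if a ^ 2 - d * b ^ 2 = 1 then
        unipotentConjSum r !![a, d * b * s⁻¹; s * b, a] else 0) = 0 := by
      intro s hs
      have hs : s ≠ 0 := Finset.ne_of_mem_erase hs
      have h : (∑ a : K, ∑ b : K, if a ^ 2 - d * b ^ 2 = 1 then
          unipotentConjSum r !![a, d * b * s⁻¹; s * b, a] else 0)
          = ∑ x : K, r !![1, x; 0, 1] * (∑ a, ∑ b, if a ^ 2 - d * b ^ 2 = 1 then
            r !![a, d * b * s⁻¹; s * b, a] else 0) * r !![1, -x; 0, 1] := by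
        simp_rw [Finset.mul_sum, Finset.sum_mul]
        symm
        rw [Finset.sum_comm]
        refine Finset.sum_congr rfl fun a _ => ?_
        rw [Finset.sum_comm]
        refine Finset.sum_congr rfl fun b _ => ?_
        split_ifs with hab
        · have hdet : (!![a, d * b * s⁻¹; s * b, a] : Matrix (Fin 2) (Fin 2) K).det = 1 := by
            rw [Matrix.det_fin_two_of]
            field_simp
            linear_combination hab
          refine Finset.sum_congr rfl fun x _ => ?_
          rw [hmul _ _ (by rw [Matrix.det_mul, hdet]; simp) (by simp), hmul _ _ (by simp) hdet]
        · simp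
      rw [h]
      simp [hC s hs]
    refine Eq.trans ?_ (Finset.sum_eq_zero this)
    symm
    rw [Finset.sum_comm]
    refine Finset.sum_congr rfl fun a _ => ?_
    rw [Finset.sum_comm]
    refine Finset.sum_congr rfl fun b _ => ?_
    split_ifs <;> simp
  have htotal := sum_sq_sub_sq_add_sum_sq_sub_nonsquare_mul_sq hK hd
    (fun a => bigCellTraceSum r (a * 2))
  rw [sum_comp_mul_right_of_ne_zero (bigCellTraceSum r) h2,
    sum_bigCellTraceSum hmul hU, smul_zero] at htotal
  have e1 : (∑ a : K, ∑ b : K, if a ^ 2 - b ^ 2 = 1 then bigCellTraceSum r (a * 2) else 0)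
      = 2 • (-(q : E)) := by
    rw [← sum_sq_sub_mul_sq_ite_eq_zero hK 1]
    refine Finset.sum_congr rfl fun a _ => Finset.sum_congr rfl fun b _ => ?_
    rw [one_mul]
    by_cases h : a ^ 2 - b ^ 2 = 1
    · rw [if_pos h, if_pos h, hsplit a b h]
    · rw [if_neg h, if_neg h]
  have e2 : (∑ a : K, ∑ b : K, if a ^ 2 - d * b ^ 2 = 1 then bigCellTraceSum r (a * 2) else 0)
      = -(2 • (q ^ 2 : E)) := by
    rw [eq_neg_iff_add_eq_zero, ← sum_sq_sub_mul_sq_ite_eq_zero hK d, ← Finset.sum_add_distrib]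
    refine Eq.trans (Finset.sum_congr rfl fun a _ => ?_) hzero
    rw [← Finset.sum_add_distrib]
    refine Finset.sum_congr rfl fun b _ => ?_
    by_cases h : a ^ 2 - d * b ^ 2 = 1
    · simp only [if_pos h, hnonsplit a b h, sub_add_cancel]
    · simp only [if_neg h, add_zero]
  rw [e1, e2] at htotal
  push_cast
  rw [← neg_eq_zero, ← htotal]
  noncomm_ring

end ConjugateSums

theorem sum_eq_zero_of_fixed_eq_zero {H F W : Type*} [Group H] [Fintype H] [Semiring F]
    [AddCommMonoid W] [Module F W] (R : H →* Module.End F W) (h : H)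
    (hh : ∀ x, R h x = x → x = 0) : ∑ x, R x = 0 := by
  refine LinearMap.ext fun y => hh _ ?_
  rw [← Module.End.mul_apply, Finset.mul_sum]
  simp_rw [← map_mul]
  exact congrArg (fun f : Module.End F W => f y) (Equiv.sum_comp (Equiv.mulLeft h) R)

section Homs

variable {K : Type*} [Field K]

/-- The upper unitriangular one-parameter subgroup of `SL(2, K)`. -/
def upperUnipotentHom (K : Type*) [Field K] : Multiplicative K →* SL(2, K) where
  toFun x := ⟨!![1, x.toAdd; 0, 1], by simp⟩
  map_one' := by ext i j; fin_cases i <;> fin_cases j <;> simp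
  map_mul' x y := Subtype.ext <| by
    change !![1, x.toAdd + y.toAdd; 0, 1] = !![1, x.toAdd; 0, 1] * !![1, y.toAdd; 0, 1]
    simp [add_comm]

theorem coe_upperUnipotentHom (x : Multiplicative K) :
    (upperUnipotentHom K x).1 = !![1, x.toAdd; 0, 1] := rfl

/-- The lower unitriangular one-parameter subgroup of `SL(2, K)`. -/
def lowerUnipotentHom (K : Type*) [Field K] : Multiplicative K →* SL(2, K) where
  toFun x := ⟨!![1, 0; x.toAdd, 1], by simp⟩
  map_one' := by ext i j; fin_cases i <;> fin_cases j <;> simp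
  map_mul' x y := Subtype.ext <| by
    change !![1, 0; x.toAdd + y.toAdd, 1] = !![1, 0; x.toAdd, 1] * !![1, 0; y.toAdd, 1]
    simp

theorem coe_lowerUnipotentHom (x : Multiplicative K) :
    (lowerUnipotentHom K x).1 = !![1, 0; x.toAdd, 1] := rfl

/-- The norm-one elements of a quadratic algebra as a torus in `SL(2, K)`, in a basis scaled
by `s`. -/
def normOneTorusHom (d : K) {s : K} (hs : s ≠ 0) :
    unitary (QuadraticAlgebra K d 0) →* SL(2, K) where
  toFun z := ⟨!![z.1.re, d * z.1.im * s⁻¹; s * z.1.im, z.1.re], by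
    have h := QuadraticAlgebra.norm_eq_one_iff_mem_unitary.mpr z.2
    rw [QuadraticAlgebra.norm_def] at h
    rw [Matrix.det_fin_two_of]
    field_simp
    linear_combination h⟩
  map_one' := by
    ext i j
    fin_cases i <;> fin_cases j <;>
      simp [QuadraticAlgebra.re_one, QuadraticAlgebra.im_one]
  map_mul' x y := Subtype.ext <| by
    change !![(x * y).1.re, d * (x * y).1.im * s⁻¹; s * (x * y).1.im, (x * y).1.re]
      = !![x.1.re, d * x.1.im * s⁻¹; s * x.1.im, x.1.re]
        * !![y.1.re, d * y.1.im * s⁻¹; s * y.1.im, y.1.re]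
    ext i j
    fin_cases i <;> fin_cases j <;> simp [Matrix.mul_apply, Fin.sum_univ_two] <;> field_simp
      <;> ring

theorem coe_normOneTorusHom (d : K) {s : K} (hs : s ≠ 0) (z : unitary (QuadraticAlgebra K d 0)) :
    (normOneTorusHom d hs z).1 = !![z.1.re, d * z.1.im * s⁻¹; s * z.1.im, z.1.re] := rfl

theorem orderOf_of_hom_multiplicative_zmod {G : Type*} [Group G] {p : ℕ} [Fact p.Prime]
    (f : Multiplicative (ZMod p) →* G) (hf : f (Multiplicative.ofAdd 1) ≠ 1) :
    orderOf (f (Multiplicative.ofAdd 1)) = p := by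
  refine orderOf_eq_prime ?_ hf
  rw [← map_pow, ← ofAdd_nsmul]
  simp

theorem entry_eq_zero_of_mem_center {A : SL(2, K)} (hA : A ∈ Subgroup.center SL(2, K))
    {i j : Fin 2} (hij : i ≠ j) : A.1 i j = 0 := by
  obtain ⟨r, -, hr⟩ := Matrix.SpecialLinearGroup.mem_center_iff.mp hA
  rw [← hr]
  simp [hij]

theorem mk_upperUnipotentHom_ne_one :
    (QuotientGroup.mk (upperUnipotentHom K (Multiplicative.ofAdd 1)) : PSL(2, K)) ≠ 1 := by
  intro h
  have := entry_eq_zero_of_mem_center ((QuotientGroup.eq_one_iff _).mp h) zero_ne_one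
  simp [coe_upperUnipotentHom] at this

theorem mk_lowerUnipotentHom_ne_one :
    (QuotientGroup.mk (lowerUnipotentHom K (Multiplicative.ofAdd 1)) : PSL(2, K)) ≠ 1 := by
  intro h
  have := entry_eq_zero_of_mem_center ((QuotientGroup.eq_one_iff _).mp h) one_ne_zero
  simp [coe_lowerUnipotentHom] at this

theorem neg_one_mem_center : (-1 : SL(2, K)) ∈ Subgroup.center SL(2, K) :=
  Subgroup.mem_center_iff.mpr fun g => by simp

theorem two_dvd_card_PSL2 : 2 ∣ Nat.card PSL(2, K) := by
  let A : SL(2, K) := ⟨!![0, -1; 1, 0], by simp⟩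
  have hA : A ^ 2 = -1 := by
    refine Subtype.ext ?_
    rw [Matrix.SpecialLinearGroup.coe_pow, Matrix.SpecialLinearGroup.coe_neg,
      Matrix.SpecialLinearGroup.coe_one]
    change !![0, -1; 1, 0] ^ 2 = _
    simp [sq, Matrix.one_fin_two]
  have h : orderOf (QuotientGroup.mk A : PSL(2, K)) = 2 := by
    refine orderOf_eq_prime ?_ fun h => ?_
    · rw [← QuotientGroup.mk_pow, hA]
      exact (QuotientGroup.eq_one_iff _).mpr neg_one_mem_center
    · have := entry_eq_zero_of_mem_center ((QuotientGroup.eq_one_iff _).mp h) one_ne_zero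
      simp [A] at this
  exact h.symm.dvd.trans (orderOf_dvd_natCard _)

theorem normOneTorusHom_mem_center_iff {d : K} (hd : ¬ IsSquare d) {s : K} (hs : s ≠ 0)
    (z : unitary (QuadraticAlgebra K d 0)) :
    normOneTorusHom d hs z ∈ Subgroup.center SL(2, K) ↔ z ^ 2 = 1 := by
  have : Fact (∀ r : K, r ^ 2 ≠ d + 0 * r) := ⟨fun r hr => hd ⟨r, by linear_combination -hr⟩⟩
  have hz := QuadraticAlgebra.norm_eq_one_iff_mem_unitary.mpr z.2
  rw [QuadraticAlgebra.norm_def] at hz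
  constructor
  · intro h
    have := entry_eq_zero_of_mem_center h one_ne_zero
    have him : z.1.im = 0 := by simpa [coe_normOneTorusHom, hs] using this
    rw [him] at hz
    ext
    · simp [sq, him, QuadraticAlgebra.re_one]
      linear_combination hz
    · simp [sq, him, QuadraticAlgebra.im_one]
  · intro h
    have h' : z.1 ^ 2 = 1 := congrArg Subtype.val h
    rcases sq_eq_one_iff.mp h' with h | h
    · have : z = 1 := Subtype.ext h
      rw [this, map_one]
      exact one_mem _
    · convert neg_one_mem_center
      refine Subtype.ext ?_
      rw [coe_normOneTorusHom, h, Matrix.SpecialLinearGroup.coe_neg,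
        Matrix.SpecialLinearGroup.coe_one]
      simp [QuadraticAlgebra.re_one, QuadraticAlgebra.im_one, Matrix.one_fin_two]

end Homs

section Torus

variable {K : Type*} [Field K] [Fintype K] [DecidableEq K]

theorem sum_unitary_quadraticAlgebra (d : K) [Fintype (unitary (QuadraticAlgebra K d 0))]
    {E : Type*} [AddCommMonoid E] (f : K → K → E) :
    (∑ z : unitary (QuadraticAlgebra K d 0), f z.1.re z.1.im)
      = ∑ a, ∑ b, if a ^ 2 - d * b ^ 2 = 1 then f a b else 0 := by
  rw [← Fintype.sum_prod_type' (f := fun a b : K => if a ^ 2 - d * b ^ 2 = 1 then f a b else 0),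
    ← Finset.sum_filter]
  have h : ∀ z : QuadraticAlgebra K d 0, z ∈ unitary (QuadraticAlgebra K d 0) ↔
      z.re ^ 2 - d * z.im ^ 2 = 1 := by
    intro z
    rw [← QuadraticAlgebra.norm_eq_one_iff_mem_unitary, QuadraticAlgebra.norm_def]
    ring_nf
  refine Finset.sum_bij (fun z _ => (z.1.re, z.1.im)) (fun z _ => ?_) (fun z _ z' _ hzz' => ?_)
    (fun p hp => ?_) (fun z _ => rfl)
  · simpa using (h z.1).mp z.2
  · simp only [Prod.mk.injEq] at hzz'
    exact Subtype.ext (QuadraticAlgebra.ext hzz'.1 hzz'.2)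
  · exact ⟨⟨⟨p.1, p.2⟩, (h _).mpr (by simpa using hp)⟩, Finset.mem_univ _, rfl⟩

theorem exists_orderOf_mk_normOneTorusHom (hK : ringChar K ≠ 2) {d : K} (hd : ¬ IsSquare d) :
    ∃ z : unitary (QuadraticAlgebra K d 0), ∀ {s : K} (hs : s ≠ 0),
      orderOf (QuotientGroup.mk (normOneTorusHom d hs z) : PSL(2, K))
        = (Fintype.card K + 1) / 2 := by
  classical
  have : Fact (∀ r : K, r ^ 2 ≠ d + 0 * r) := ⟨fun r hr => hd ⟨r, by linear_combination -hr⟩⟩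
  have : Fintype (QuadraticAlgebra K d 0) := .ofEquiv _ (QuadraticAlgebra.equivProd d 0).symm
  have : IsCyclic (unitary (QuadraticAlgebra K d 0)) :=
    isCyclic_of_injective_ringHom (unitary (QuadraticAlgebra K d 0)).subtype
      Subtype.val_injective
  have hcard : Nat.card (unitary (QuadraticAlgebra K d 0)) = Fintype.card K + 1 := by
    rw [Nat.card_eq_fintype_card, ← Finset.card_univ, Finset.card_eq_sum_ones,
      sum_unitary_quadraticAlgebra d fun _ _ => 1, card_sq_sub_nonsquare_mul_sq_eq_one hK hd]
  obtain ⟨z, hz⟩ := IsCyclic.exists_ofOrder_eq_natCard (α := unitary (QuadraticAlgebra K d 0))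
  refine ⟨z, fun {s} hs => ?_⟩
  have hodd := FiniteField.odd_card_of_char_ne_two hK
  have hpow : ∀ k : ℕ, (QuotientGroup.mk (normOneTorusHom d hs z) : PSL(2, K)) ^ k = 1 ↔
      Fintype.card K + 1 ∣ k * 2 := by
    intro k
    rw [← QuotientGroup.mk_pow, ← map_pow, QuotientGroup.eq_one_iff,
      normOneTorusHom_mem_center_iff hd, ← pow_mul, ← orderOf_dvd_iff_pow_eq_one, hz, hcard]
  obtain ⟨m, hm⟩ : ∃ m, Fintype.card K + 1 = m * 2 := ⟨(Fintype.card K + 1) / 2, by omega⟩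
  rw [hm] at hpow ⊢
  rw [Nat.mul_div_cancel _ two_pos]
  exact Nat.dvd_antisymm (orderOf_dvd_of_pow_eq_one ((hpow m).mpr dvd_rfl))
    (Nat.dvd_of_mul_dvd_mul_right two_pos ((hpow _).mp (pow_orderOf_eq_one _)))

end Torus

theorem psl2_fixed_vector
    (v : ℕ) (hv : v.Prime) (hv3 : 3 < v)
    (w : ℕ) (hw : w.Prime) (F : Type*) [Field F] [CharP F w]
    (W : Type*) [AddCommGroup W] [Module F W] [Nontrivial W] [FiniteDimensional F W]
    (hwG : ¬ w ∣ Nat.card PSL(2, ZMod v))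
    (ρ : PSL(2, ZMod v) →* (W ≃ₗ[F] W)) :
    ∃ g : PSL(2, ZMod v), (orderOf g = v ∨ orderOf g = (v + 1) / 2) ∧
      ∃ x : W, x ≠ 0 ∧ ρ g x = x := by
  classical
  by_contra! hfix
  have : Fact v.Prime := ⟨hv⟩
  have hK : ringChar (ZMod v) ≠ 2 := by rw [ZMod.ringChar_zmod_n]; omega
  obtain ⟨d, hd⟩ := FiniteField.exists_nonsquare hK
  let R : SL(2, ZMod v) →* Module.End F W :=
    (LinearEquiv.automorphismGroup.toLinearMapMonoidHom.comp ρ).comp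
      (QuotientGroup.mk' (Subgroup.center SL(2, ZMod v)))
  have hR : ∀ A : SL(2, ZMod v),
      (orderOf (QuotientGroup.mk A : PSL(2, ZMod v)) = v ∨
        orderOf (QuotientGroup.mk A : PSL(2, ZMod v)) = (v + 1) / 2) →
      ∀ x, R A x = x → x = 0 := by
    intro A hA x hx
    by_contra hx0
    exact hfix (QuotientGroup.mk A) hA x hx0 hx
  let r : Matrix (Fin 2) (Fin 2) (ZMod v) → Module.End F W :=
    fun M => if h : M.det = 1 then R ⟨M, h⟩ else 0
  have hr : ∀ A : SL(2, ZMod v), r A.1 = R A := fun A => dif_pos A.2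
  have hupper : orderOf (QuotientGroup.mk (upperUnipotentHom _ (.ofAdd 1)) : PSL(2, ZMod v)) = v :=
    orderOf_of_hom_multiplicative_zmod ((QuotientGroup.mk' _).comp (upperUnipotentHom _))
      mk_upperUnipotentHom_ne_one
  have hlower : orderOf (QuotientGroup.mk (lowerUnipotentHom _ (.ofAdd 1)) : PSL(2, ZMod v)) = v :=
    orderOf_of_hom_multiplicative_zmod ((QuotientGroup.mk' _).comp (lowerUnipotentHom _))
      mk_lowerUnipotentHom_ne_one
  obtain ⟨z, hz⟩ := exists_orderOf_mk_normOneTorusHom hK hd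
  rw [ZMod.card] at hz
  have hzero := two_mul_card_mul_card_add_one_eq_zero (r := r)
    (fun M N hM hN => by
      let A : SL(2, ZMod v) := ⟨M, hM⟩
      let B : SL(2, ZMod v) := ⟨N, hN⟩
      exact (hr (A * B)).trans ((map_mul R A B).trans (congrArg₂ _ (hr A).symm (hr B).symm)))
    hK hd
    ((hr 1).trans (map_one R))
    (by
      rw [← Matrix.SpecialLinearGroup.coe_one, ← Matrix.SpecialLinearGroup.coe_neg, hr]
      have : (QuotientGroup.mk (-1) : PSL(2, ZMod v)) = 1 :=
        (QuotientGroup.eq_one_iff _).mpr neg_one_mem_center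
      simp only [R, MonoidHom.comp_apply, QuotientGroup.mk'_apply, this, map_one])
    (by
      rw [← sum_eq_zero_of_fixed_eq_zero (R.comp (upperUnipotentHom _)) _ (hR _ (.inl hupper))]
      exact Fintype.sum_equiv Multiplicative.ofAdd _ _ fun x => hr (upperUnipotentHom _ _))
    (by
      rw [← sum_eq_zero_of_fixed_eq_zero (R.comp (lowerUnipotentHom _)) _ (hR _ (.inl hlower))]
      exact Fintype.sum_equiv Multiplicative.ofAdd _ _ fun x => hr (lowerUnipotentHom _ _))
    (by
      intro s hs
      have : Fintype (QuadraticAlgebra (ZMod v) d 0) :=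
        .ofEquiv _ (QuadraticAlgebra.equivProd d 0).symm
      rw [← sum_unitary_quadraticAlgebra d fun a b => r !![a, d * b * s⁻¹; s * b, a],
        ← sum_eq_zero_of_fixed_eq_zero (R.comp (normOneTorusHom d hs)) z (hR _ (.inr (hz hs)))]
      exact Finset.sum_congr rfl fun z _ => hr (normOneTorusHom d hs z))
  rw [ZMod.card] at hzero
  obtain ⟨x, hx⟩ := exists_ne (0 : W)
  have hF : ((2 * v * (v + 1) : ℕ) : F) = 0 := by
    have := congrArg (fun f : Module.End F W => f x) hzero
    rw [← Nat.smul_one_eq_cast, ← Nat.cast_smul_eq_nsmul F] at this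
    simpa [hx, -Nat.cast_mul] using this
  have hdvd := (CharP.cast_eq_zero_iff F w _).mp hF
  have h2 : ¬ w ∣ 2 := fun h => hwG (h.trans two_dvd_card_PSL2)
  have h3 : ¬ w ∣ v := fun h => hwG (h.trans (hupper.symm.dvd.trans (orderOf_dvd_natCard _)))
  have h4 : ¬ w ∣ (v + 1) / 2 := fun h =>
    hwG (h.trans ((hz one_ne_zero).symm.dvd.trans (orderOf_dvd_natCard _)))
  have hodd := hv.eq_two_or_odd
  rw [show v + 1 = 2 * ((v + 1) / 2) by omega] at hdvd
  simp only [hw.dvd_mul] at hdvd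
  tauto
end

section
/- Let q = p^f be a power of an odd prime p and let L = L₄(q) = PSL(4, 𝔽_q). Then a positive integer m lies in ω(L) if and only if m divides at least one of the following numbers: (q²+1)(q+1)/gcd(4, q−1), (q³−1)/gcd(4, q−1), q²−1, p(q²−1)/gcd(4, q−1), p(q−1), or (in the case p = 3) the number 9. -/
open scoped MatrixGroups

/-- The spectrum of a group: the set of orders of its elements. -/
def specSet (G : Type*) [Group G] : Set ℕ := {n | ∃ g : G, orderOf g = n}

open Polynomial

/-- `m` divides one of the numbers generating the spectrum of `PSL(4, 𝔽_q)`, `q` a power of `p`. -/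
def DvdSpectrumBound (p q m : ℕ) : Prop :=
  m ∣ (q ^ 2 + 1) * (q + 1) / Nat.gcd 4 (q - 1) ∨
  m ∣ (q ^ 3 - 1) / Nat.gcd 4 (q - 1) ∨
  m ∣ q ^ 2 - 1 ∨
  m ∣ p * (q ^ 2 - 1) / Nat.gcd 4 (q - 1) ∨
  m ∣ p * (q - 1) ∨
  (p = 3 ∧ m ∣ 9)

section Arithmetic

variable {q : ℕ}

lemma sq_sub_one_div_gcd :
    (q ^ 2 - 1) / Nat.gcd 4 (q - 1) = (q + 1) * ((q - 1) / Nat.gcd 4 (q - 1)) := by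
  rw [← Nat.mul_div_assoc _ (Nat.gcd_dvd_right _ _), ← Nat.sq_sub_sq q 1, one_pow]

lemma cube_sub_one_eq (hq : 1 < q) : q ^ 3 - 1 = (1 + q + q ^ 2) * (q - 1) := by
  obtain ⟨r, rfl⟩ := Nat.exists_eq_add_of_lt hq
  simp only [Nat.add_sub_cancel]
  rw [Nat.sub_eq_iff_eq_add (Nat.one_le_pow _ _ (by omega))]
  ring

lemma gcd_dvd_sq_sub_one : Nat.gcd 4 (q - 1) ∣ q ^ 2 - 1 := by
  have := Nat.sq_sub_sq q 1
  rw [one_pow] at this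
  rw [this]
  exact (Nat.gcd_dvd_right _ _).mul_left _

lemma gcd_dvd_cube_sub_one (hq : 1 < q) : Nat.gcd 4 (q - 1) ∣ q ^ 3 - 1 := by
  rw [cube_sub_one_eq hq]
  exact (Nat.gcd_dvd_right _ _).mul_left _

lemma gcd_dvd_add_three (hq : 1 < q) : Nat.gcd 4 (q - 1) ∣ q + 3 := by
  have : q + 3 = 4 + (q - 1) := by omega
  rw [this]
  exact dvd_add (Nat.gcd_dvd_left _ _) (Nat.gcd_dvd_right _ _)

lemma gcd_dvd_sq_add_one_mul (hq : 1 < q) :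
    Nat.gcd 4 (q - 1) ∣ (q ^ 2 + 1) * (q + 1) := by
  have : (q ^ 2 + 1) * (q + 1) = 4 + (q - 1) * (q ^ 2 + 2 * q + 3) := by
    obtain ⟨r, rfl⟩ := Nat.exists_eq_add_of_lt hq
    simp only [Nat.add_sub_cancel]
    ring
  rw [this]
  exact dvd_add (Nat.gcd_dvd_left _ _) ((Nat.gcd_dvd_right _ _).mul_right _)

end Arithmetic

section PolynomialDivisibility

variable {F : Type*} [Field F]

lemma dvd_X_pow_mul_sub {f : F[X]} {n : ℕ} {c : F} (h : f ∣ X ^ n - C c) (k : ℕ) :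
    f ∣ X ^ (n * k) - C (c ^ k) := by
  rw [pow_mul, C_pow]
  exact h.trans (sub_dvd_pow_sub_pow _ _ _)

lemma pow_char_dvd_X_pow_mul_sub {p : ℕ} [Fact p.Prime] [CharP F p] {f : F[X]} {n : ℕ} {c : F}
    (h : f ∣ X ^ n - C c) : f ^ p ∣ X ^ (p * n) - C (c ^ p) := by
  rw [mul_comm p n, pow_mul, C_pow, ← sub_pow_char]
  exact pow_dvd_pow_of_dvd h p

lemma X_sub_C_dvd_X_pow_sub (a : F) (n : ℕ) : X - C a ∣ X ^ n - C (a ^ n) := by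
  rw [C_pow]
  exact sub_dvd_pow_sub_pow _ _ _

lemma X_sub_C_dvd_X_pow_sub_iff {a c : F} {n : ℕ} : X - C a ∣ X ^ n - C c ↔ a ^ n = c := by
  rw [dvd_iff_isRoot, IsRoot.def, eval_sub, eval_pow, eval_X, eval_C, sub_eq_zero]

lemma eq_of_dvd_X_pow_sub {f : F[X]} (hf : 0 < f.natDegree) {n : ℕ} {a b : F}
    (ha : f ∣ X ^ n - C a) (hb : f ∣ X ^ n - C b) : a = b := by
  have h : f ∣ C (b - a) := by
    have := dvd_sub ha hb
    rwa [sub_sub_sub_cancel_left, ← C_sub] at this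
  by_contra hab
  have := natDegree_le_of_dvd h (C_ne_zero.2 (sub_ne_zero.2 (Ne.symm hab)))
  rw [natDegree_C] at this
  omega

lemma prod_X_sub_C_eq_X_pow_card_sub_X [Fintype F] :
    ∏ a : F, (X - C a) = X ^ Fintype.card F - X := by
  have hc : 1 < Fintype.card F := Fintype.one_lt_card
  have hd := FiniteField.X_pow_card_sub_X_natDegree_eq F hc
  have hr := FiniteField.roots_X_pow_card_sub_X F
  have hm : (X ^ Fintype.card F - X : F[X]).Monic :=
    monic_X_pow_sub (by rw [degree_X]; exact_mod_cast hc)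
  generalize (X ^ Fintype.card F - X : F[X]) = g at hd hr hm
  rw [Finset.prod_eq_multiset_prod, ← hr]
  exact prod_multiset_X_sub_C_of_monic_of_roots_card_eq hm (by rw [hr, hd]; rfl)

variable [Fintype F]

lemma Irreducible.exists_dvd_X_pow_sub {f : F[X]} (hf : Irreducible f) {n d : ℕ}
    (hd : d ∣ Fintype.card F - 1) (h : f ∣ X ^ (n * d) - 1) :
    ∃ c : F, c ^ d = 1 ∧ f ∣ X ^ n - C c := by
  have h1 : f ∣ X ^ (n * (Fintype.card F - 1)) - 1 := by
    obtain ⟨e, he⟩ := hd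
    rw [he, ← mul_assoc]
    have := dvd_X_pow_mul_sub (f := f) (n := n * d) (c := (1 : F)) (by rwa [C_1]) e
    rwa [one_pow, C_1] at this
  have h2 : f ∣ ∏ a : F, (X ^ n - C a) := by
    have h3 := congrArg (fun g : F[X] => g.comp (X ^ n)) (prod_X_sub_C_eq_X_pow_card_sub_X (F := F))
    simp only [prod_comp, sub_comp, X_comp, C_comp, X_pow_comp] at h3
    rw [h3]
    convert h1.mul_right (X ^ n) using 1
    rw [sub_mul, one_mul, pow_mul, ← pow_succ, Nat.sub_add_cancel Fintype.card_pos]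
  obtain ⟨c, -, hc⟩ := hf.prime.exists_mem_finset_dvd h2
  exact ⟨c, eq_of_dvd_X_pow_sub hf.natDegree_pos (dvd_X_pow_mul_sub hc d) (by rwa [C_1]), hc⟩

/-- The norm of a root of an irreducible polynomial over a finite field is a power of the root. -/
lemma Irreducible.dvd_X_pow_geomSum_sub {f : F[X]} (hf : Irreducible f) (hm : f.Monic) :
    f ∣ X ^ (∑ i ∈ Finset.range f.natDegree, Fintype.card F ^ i) -
      C ((-1) ^ f.natDegree * f.coeff 0) := by
  have : Fact (Irreducible f) := ⟨hf⟩
  let pb := AdjoinRoot.powerBasis hm.ne_zero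
  have : Module.Finite F (AdjoinRoot f) := pb.finite
  have : Finite (AdjoinRoot f) := Module.finite_of_finite F
  have hn := Algebra.PowerBasis.norm_gen_eq_coeff_zero_minpoly pb
  rw [AdjoinRoot.minpoly_powerBasis_gen_of_monic hm] at hn
  have hp := FiniteField.algebraMap_norm_eq_pow_sum F (AdjoinRoot f) pb.gen
  rw [hn, pb.finrank, Nat.card_eq_fintype_card] at hp
  rw [← AdjoinRoot.mk_eq_zero, map_sub, sub_eq_zero, map_pow, AdjoinRoot.mk_X, AdjoinRoot.mk_C]
  exact hp.symm

end PolynomialDivisibility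

section Factorization

variable {F : Type*} [Field F]

lemma Polynomial.Monic.eq_X_sub_C {f : F[X]} (hm : f.Monic) (hd : f.natDegree = 1) :
    ∃ a, f = X - C a :=
  ⟨-f.coeff 0, by rw [C_neg, sub_neg_eq_add]; exact hm.eq_X_add_C hd⟩

lemma Polynomial.Monic.irreducible_or_eq_of_natDegree_two {f : F[X]} (hm : f.Monic)
    (hd : f.natDegree = 2) : Irreducible f ∨ ∃ a b, f = (X - C a) * (X - C b) := by
  by_cases h : Irreducible f
  · exact .inl h
  rw [hm.irreducible_iff_natDegree', not_and] at h
  have := h (by rintro rfl; simp at hd)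
  push Not at this
  obtain ⟨u, v, hu, hv, rfl, hvd⟩ := this
  rw [hd, Finset.mem_Ioc] at hvd
  rw [hu.natDegree_mul hv] at hd
  obtain ⟨a, rfl⟩ := hu.eq_X_sub_C (by omega)
  obtain ⟨b, rfl⟩ := hv.eq_X_sub_C (by omega)
  exact .inr ⟨a, b, rfl⟩

lemma Polynomial.Monic.irreducible_or_eq_of_natDegree_three {f : F[X]} (hm : f.Monic)
    (hd : f.natDegree = 3) :
    Irreducible f ∨ ∃ a g, g.Monic ∧ g.natDegree = 2 ∧ f = (X - C a) * g := by
  by_cases h : Irreducible f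
  · exact .inl h
  rw [hm.irreducible_iff_natDegree', not_and] at h
  have := h (by rintro rfl; simp at hd)
  push Not at this
  obtain ⟨u, v, hu, hv, rfl, hvd⟩ := this
  rw [hd, Finset.mem_Ioc] at hvd
  rw [hu.natDegree_mul hv] at hd
  obtain ⟨b, rfl⟩ := hv.eq_X_sub_C (by omega)
  exact .inr ⟨b, u, hu, by omega, mul_comm _ _⟩

lemma Polynomial.Monic.irreducible_or_eq_of_natDegree_four {f : F[X]} (hm : f.Monic)
    (hd : f.natDegree = 4) :
    Irreducible f ∨
    (∃ a g, g.Monic ∧ g.natDegree = 3 ∧ Irreducible g ∧ f = (X - C a) * g) ∨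
    ∃ g h, g.Monic ∧ g.natDegree = 2 ∧ h.Monic ∧ h.natDegree = 2 ∧ f = g * h := by
  by_cases h : Irreducible f
  · exact .inl h
  rw [hm.irreducible_iff_natDegree', not_and] at h
  have := h (by rintro rfl; simp at hd)
  push Not at this
  obtain ⟨u, v, hu, hv, rfl, hvd⟩ := this
  rw [hd, Finset.mem_Ioc] at hvd
  rw [hu.natDegree_mul hv] at hd
  obtain hv2 | hv1 : v.natDegree = 2 ∨ v.natDegree = 1 := by omega
  · exact .inr (.inr ⟨u, v, hu, by omega, hv, hv2, rfl⟩)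
  obtain ⟨b, rfl⟩ := hv.eq_X_sub_C hv1
  obtain hi | ⟨a, g, hg, hgd, rfl⟩ := hu.irreducible_or_eq_of_natDegree_three (by omega)
  · exact .inr (.inl ⟨b, u, hu, by omega, hi, mul_comm _ _⟩)
  · refine .inr (.inr ⟨g, (X - C a) * (X - C b), hg, hgd,
      (monic_X_sub_C a).mul (monic_X_sub_C b), ?_, by ring⟩)
    rw [(monic_X_sub_C a).natDegree_mul (monic_X_sub_C b), natDegree_X_sub_C, natDegree_X_sub_C]

end Factorization

section UpperBound

variable {F : Type*} [Field F] [Fintype F] {p q : ℕ}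

lemma pow_sub_one_eq_one (hq : Fintype.card F = q) {a : F} (ha : a ≠ 0) : a ^ (q - 1) = 1 :=
  hq ▸ FiniteField.pow_card_sub_one_eq_one a ha

lemma X_sub_C_dvd_X_pow_sub_one (hq : Fintype.card F = q) {a : F} (ha : a ≠ 0) :
    X - C a ∣ X ^ (q - 1) - C 1 :=
  X_sub_C_dvd_X_pow_sub_iff.2 (pow_sub_one_eq_one hq ha)

lemma X_sub_C_dvd_X_pow_sq_sub_one (hq : Fintype.card F = q) {a : F} (ha : a ≠ 0) :
    X - C a ∣ X ^ (q ^ 2 - 1) - C 1 := by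
  have h := Nat.sq_sub_sq q 1
  rw [one_pow] at h
  rw [X_sub_C_dvd_X_pow_sub_iff, h, mul_comm, pow_mul, pow_sub_one_eq_one hq ha, one_pow]

lemma Irreducible.dvd_X_pow_add_one_sub (hq : Fintype.card F = q) {f : F[X]}
    (hf : Irreducible f) (hm : f.Monic) (hd : f.natDegree = 2) :
    f ∣ X ^ (q + 1) - C (f.coeff 0) := by
  have h := hf.dvd_X_pow_geomSum_sub hm
  rw [hd, hq] at h
  simpa [Finset.sum_range_succ, add_comm] using h

lemma Irreducible.dvd_X_pow_sq_sub_one (hq : Fintype.card F = q) {f : F[X]}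
    (hf : Irreducible f) (hm : f.Monic) (hd : f.natDegree = 2) (h0 : f.coeff 0 ≠ 0) :
    f ∣ X ^ (q ^ 2 - 1) - C 1 := by
  have h := Nat.sq_sub_sq q 1
  rw [one_pow] at h
  rw [h, ← pow_sub_one_eq_one hq h0]
  exact dvd_X_pow_mul_sub (hf.dvd_X_pow_add_one_sub hq hm hd) _

lemma exists_dvd_X_pow_sub_of_irreducible (hq : Fintype.card F = q) {f : F[X]}
    (hm : f.Monic) (hd : f.natDegree = 4) (h0 : f.coeff 0 = 1) (hf : Irreducible f) :
    ∃ c, f ∣ X ^ ((q ^ 2 + 1) * (q + 1) / Nat.gcd 4 (q - 1)) - C c := by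
  have hq1 : 1 < q := hq ▸ Fintype.one_lt_card
  have h := hf.dvd_X_pow_geomSum_sub hm
  rw [hd, hq, h0] at h
  obtain ⟨c, -, hc⟩ := hf.exists_dvd_X_pow_sub (hq ▸ Nat.gcd_dvd_right 4 (q - 1))
    (n := (q ^ 2 + 1) * (q + 1) / Nat.gcd 4 (q - 1)) (d := Nat.gcd 4 (q - 1)) (by
      rw [Nat.div_mul_cancel (gcd_dvd_sq_add_one_mul hq1)]
      convert h using 2
      · simp only [Finset.sum_range_succ, Finset.sum_range_zero]
        ring_nf
      · norm_num)
  exact ⟨c, hc⟩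

lemma exists_linear_mul_cubic_dvd_X_pow_sub (hq : Fintype.card F = q) {f : F[X]} {b : F}
    (hm : f.Monic) (hd : f.natDegree = 3) (hf : Irreducible f) (h0 : -b * f.coeff 0 = 1) :
    ∃ c, (X - C b) * f ∣ X ^ ((q ^ 3 - 1) / Nat.gcd 4 (q - 1)) - C c := by
  have hq1 : 1 < q := hq ▸ Fintype.one_lt_card
  have hb : b ≠ 0 := by rintro rfl; simp at h0
  have hN := hf.dvd_X_pow_geomSum_sub hm
  have hfb : (-1) ^ 3 * f.coeff 0 = b⁻¹ := by
    exact eq_inv_of_mul_eq_one_left ((by ring : _ = -b * f.coeff 0).trans h0)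
  rw [hd, hq, hfb] at hN
  simp only [Finset.sum_range_succ, Finset.sum_range_zero, pow_zero, pow_one, zero_add] at hN
  set n := (q ^ 3 - 1) / Nat.gcd 4 (q - 1) with hn
  obtain ⟨c, hc1, hc⟩ := hf.exists_dvd_X_pow_sub (hq ▸ Nat.gcd_dvd_right 4 (q - 1))
    (n := n) (d := Nat.gcd 4 (q - 1)) (by
      rw [hn, Nat.div_mul_cancel (gcd_dvd_cube_sub_one hq1), cube_sub_one_eq hq1]
      have := dvd_X_pow_mul_sub hN (q - 1)
      rwa [pow_sub_one_eq_one hq (inv_ne_zero hb), C_1] at this)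
  have hc0 : c ≠ 0 := by
    rintro rfl
    exact zero_ne_one (((zero_pow (Nat.gcd_pos_of_pos_left _ (by norm_num)).ne').symm).trans hc1)
  have hc4 : c ^ 4 = 1 := by
    obtain ⟨k, hk⟩ := Nat.gcd_dvd_left 4 (q - 1)
    rw [hk, pow_mul, hc1, one_pow]
  have hcq : c ^ q = c := hq ▸ FiniteField.pow_card c
  have hc3 : c ^ 3 = b⁻¹ ^ n := by
    have h1 := dvd_X_pow_mul_sub hc (1 + q + q ^ 2)
    have h2 := dvd_X_pow_mul_sub hN n
    rw [mul_comm n] at h1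
    have h3 := eq_of_dvd_X_pow_sub (by omega) h1 h2
    rwa [pow_add, pow_add, pow_one, pow_two q, pow_mul, hcq, hcq, ← pow_two, ← pow_succ] at h3
  have hbn : b ^ n = c := by
    rw [inv_pow] at hc3
    have : c ^ 3 * b ^ n = 1 := by rw [hc3]; exact inv_mul_cancel₀ (pow_ne_zero _ hb)
    exact mul_left_cancel₀ (pow_ne_zero 3 hc0) (this.trans (by rw [← hc4]; ring))
  refine ⟨c, IsCoprime.mul_dvd ?_ (X_sub_C_dvd_X_pow_sub_iff.2 hbn) hc⟩
  refine ((irreducible_X_sub_C b).isCoprime_or_dvd f).resolve_right fun h => ?_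
  have := natDegree_eq_of_degree_eq
    (degree_eq_degree_of_associated ((irreducible_X_sub_C b).associated_of_dvd hf h))
  rw [natDegree_X_sub_C] at this
  omega

variable [Fact p.Prime] [CharP F p]

lemma sq_mul_quadratic_dvd_X_pow_sub (hq : Fintype.card F = q) (hp : 2 ≤ p)
    {f : F[X]} {a : F} (hm : f.Monic) (hd : f.natDegree = 2) (hf : Irreducible f)
    (h0 : f.coeff 0 * (a * a) = 1) :
    ∃ c, f * ((X - C a) * (X - C a)) ∣ X ^ (p * (q ^ 2 - 1) / Nat.gcd 4 (q - 1)) - C c := by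
  have hq1 : 1 < q := hq ▸ Fintype.one_lt_card
  have ha : a ≠ 0 := by rintro rfl; simp at h0
  rw [Nat.mul_div_assoc _ gcd_dvd_sq_sub_one, sq_sub_one_div_gcd]
  set e := (q - 1) / Nat.gcd 4 (q - 1) with he
  have h1 : f ∣ X ^ ((q + 1) * e) - C (a ^ ((q + 1) * e)) := by
    have h2 := dvd_X_pow_mul_sub (hf.dvd_X_pow_add_one_sub hq hm hd) e
    obtain ⟨t, ht⟩ := gcd_dvd_add_three hq1
    have h3 : a ^ ((q + 1) * e) * (a * a) ^ e = 1 := by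
      rw [← pow_two, ← pow_mul, ← pow_add, ← add_mul, add_assoc, show 1 + 2 = 3 from rfl, ht,
        mul_right_comm, he, Nat.mul_div_cancel' (Nat.gcd_dvd_right _ _), pow_mul,
        pow_sub_one_eq_one hq ha, one_pow]
    have h4 : f.coeff 0 ^ e * (a * a) ^ e = 1 := by rw [← mul_pow, h0, one_pow]
    rwa [mul_right_cancel₀ (pow_ne_zero e (mul_ne_zero ha ha)) (h3.trans h4.symm)]
  have h5 : f * (X - C a) ∣ X ^ ((q + 1) * e) - C (a ^ ((q + 1) * e)) := by
    refine IsCoprime.mul_dvd (IsCoprime.symm ?_) h1 (X_sub_C_dvd_X_pow_sub _ _)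
    refine ((irreducible_X_sub_C a).isCoprime_or_dvd f).resolve_right fun h => ?_
    have := natDegree_eq_of_degree_eq
      (degree_eq_degree_of_associated ((irreducible_X_sub_C a).associated_of_dvd hf h))
    rw [natDegree_X_sub_C] at this
    omega
  refine ⟨_, dvd_trans ?_ (pow_char_dvd_X_pow_mul_sub h5)⟩
  refine dvd_trans ?_ (pow_dvd_pow _ hp)
  exact ⟨f, by ring⟩

lemma exists_split_quartic_dvd_X_pow_sub (hq : Fintype.card F = q) (hp : 3 ≤ p)
    {a b c d : F} (h0 : a * b * (c * d) ≠ 0) :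
    ∃ n, DvdSpectrumBound p q n ∧
      ∃ e, ((X - C a) * (X - C b)) * ((X - C c) * (X - C d)) ∣ X ^ n - C e := by
  have key : ∀ {x y z w : F}, x ≠ y → x ≠ 0 → y ≠ 0 → z ≠ 0 → w ≠ 0 →
      (X - C x) * (X - C y) * (X - C z) * (X - C w) ∣ X ^ (p * (q - 1)) - C (1 ^ p) := by
    intro x y z w hxy hx hy hz hw
    have h := (IsCoprime.mul_dvd (isCoprime_X_sub_C_of_isUnit_sub (sub_ne_zero.2 hxy).isUnit)
      (X_sub_C_dvd_X_pow_sub_one hq hx) (X_sub_C_dvd_X_pow_sub_one hq hy))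
    refine dvd_trans ?_ (pow_char_dvd_X_pow_mul_sub dvd_rfl)
    refine dvd_trans ?_ (pow_dvd_pow _ hp)
    rw [pow_three', mul_assoc _ _ (X ^ _ - _)]
    rw [mul_assoc]
    exact mul_dvd_mul h
      (mul_dvd_mul (X_sub_C_dvd_X_pow_sub_one hq hz) (X_sub_C_dvd_X_pow_sub_one hq hw))
  have hb : DvdSpectrumBound p q (p * (q - 1)) := .inr (.inr (.inr (.inr (.inl dvd_rfl))))
  have ha0 : a ≠ 0 := by rintro rfl; simp at h0
  have hb0 : b ≠ 0 := by rintro rfl; simp at h0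
  have hc0 : c ≠ 0 := by rintro rfl; simp at h0
  have hd0 : d ≠ 0 := by rintro rfl; simp at h0
  by_cases hab : a = b
  swap
  · exact ⟨_, hb, _, (Eq.dvd (by ring)).trans (key hab ha0 hb0 hc0 hd0)⟩
  by_cases hac : a = c
  swap
  · exact ⟨_, hb, _, (Eq.dvd (by ring)).trans (key hac ha0 hc0 hb0 hd0)⟩
  by_cases had : a = d
  swap
  · exact ⟨_, hb, _, (Eq.dvd (by ring)).trans (key had ha0 hd0 hb0 hc0)⟩
  subst hab hac had
  have h1 : (X - C a) ^ p ∣ X ^ (p * 1) - C (a ^ p) :=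
    pow_char_dvd_X_pow_mul_sub (by rw [pow_one])
  have h4 : (X - C a) * (X - C a) * ((X - C a) * (X - C a)) = (X - C a) ^ 4 := by ring
  rw [h4]
  obtain rfl | hp4 := hp.eq_or_lt
  · refine ⟨9, .inr (.inr (.inr (.inr (.inr ⟨rfl, dvd_rfl⟩)))), (a ^ 3) ^ 3, ?_⟩
    have h9 := pow_char_dvd_X_pow_mul_sub (p := 3) h1
    rw [← pow_mul, show 3 * (3 * 1) = 9 from rfl] at h9
    exact (pow_dvd_pow _ (by norm_num)).trans h9
  · rw [mul_one] at h1
    exact ⟨p, .inr (.inr (.inr (.inr (.inl (dvd_mul_right _ _))))), _, (pow_dvd_pow _ hp4).trans h1⟩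

lemma exists_quadratic_mul_quadratic_dvd_X_pow_sub (hq : Fintype.card F = q) (hp : 3 ≤ p)
    {f g : F[X]} (hf : f.Monic) (hfd : f.natDegree = 2) (hg : g.Monic) (hgd : g.natDegree = 2)
    (h0 : f.coeff 0 * g.coeff 0 = 1) :
    ∃ n, DvdSpectrumBound p q n ∧ ∃ c, f * g ∣ X ^ n - C c := by
  wlog hi : ¬ Irreducible f → ¬ Irreducible g generalizing f g
  · rw [mul_comm f g]
    exact this hg hgd hf hfd (by rwa [mul_comm]) (by tauto)
  have hq1 : 1 < q := hq ▸ Fintype.one_lt_card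
  have hf0 : f.coeff 0 ≠ 0 := left_ne_zero_of_mul_eq_one h0
  have hg0 : g.coeff 0 ≠ 0 := right_ne_zero_of_mul_eq_one h0
  have hsq : DvdSpectrumBound p q (q ^ 2 - 1) := .inr (.inr (.inl dvd_rfl))
  have hpsq : DvdSpectrumBound p q (p * (q ^ 2 - 1) / Nat.gcd 4 (q - 1)) :=
    .inr (.inr (.inr (.inl dvd_rfl)))
  by_cases hfi : Irreducible f
  · obtain hgi | ⟨a, b, rfl⟩ := hg.irreducible_or_eq_of_natDegree_two hgd
    · obtain h | h := hfi.isCoprime_or_dvd g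
      · exact ⟨_, hsq, 1, h.mul_dvd (hfi.dvd_X_pow_sq_sub_one hq hf hfd hf0)
          (hgi.dvd_X_pow_sq_sub_one hq hg hgd hg0)⟩
      · have hfg := eq_of_monic_of_associated hf hg (hfi.associated_of_dvd hgi h)
        subst hfg
        refine ⟨p * (q + 1), ?_, _, dvd_trans ?_
          (pow_char_dvd_X_pow_mul_sub (p := p) (hfi.dvd_X_pow_add_one_sub hq hf hfd))⟩
        · refine .inr (.inr (.inr (.inl ?_)))
          rw [Nat.mul_div_assoc _ gcd_dvd_sq_sub_one, sq_sub_one_div_gcd]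
          exact mul_dvd_mul_left _ (dvd_mul_right _ _)
        · rw [← pow_two]
          exact pow_dvd_pow _ (by omega)
    · simp only [mul_coeff_zero, coeff_sub, coeff_X_zero, coeff_C_zero, zero_sub, neg_mul_neg]
        at h0 hg0
      by_cases hab : a = b
      · subst hab
        exact ⟨_, hpsq, sq_mul_quadratic_dvd_X_pow_sub hq (by omega) hf hfd hfi h0⟩
      · refine ⟨_, hsq, 1, ?_⟩
        have hcop : ∀ x : F, IsCoprime f (X - C x) := fun x => by
          refine (hfi.isCoprime_or_dvd _).resolve_right fun h => ?_
          have := natDegree_le_of_dvd h (X_sub_C_ne_zero x)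
          rw [natDegree_X_sub_C] at this
          omega
        refine ((hcop a).mul_right (hcop b)).mul_dvd (hfi.dvd_X_pow_sq_sub_one hq hf hfd hf0) ?_
        exact (isCoprime_X_sub_C_of_isUnit_sub (sub_ne_zero.2 hab).isUnit).mul_dvd
          (X_sub_C_dvd_X_pow_sq_sub_one hq (left_ne_zero_of_mul hg0))
          (X_sub_C_dvd_X_pow_sq_sub_one hq (right_ne_zero_of_mul hg0))
  · obtain ⟨a, b, rfl⟩ := (hf.irreducible_or_eq_of_natDegree_two hfd).resolve_left hfi
    obtain ⟨c, d, rfl⟩ := (hg.irreducible_or_eq_of_natDegree_two hgd).resolve_left (hi hfi)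
    refine exists_split_quartic_dvd_X_pow_sub hq hp ?_
    simp only [mul_coeff_zero, coeff_sub, coeff_X_zero, coeff_C_zero, zero_sub, neg_mul_neg] at h0
    exact h0 ▸ one_ne_zero

lemma exists_dvd_X_pow_sub (hq : Fintype.card F = q) (hp : 3 ≤ p) {f : F[X]} (hm : f.Monic)
    (hd : f.natDegree = 4) (h0 : f.coeff 0 = 1) :
    ∃ n, DvdSpectrumBound p q n ∧ ∃ c, f ∣ X ^ n - C c := by
  obtain hf | ⟨b, g, hg, hgd, hgi, rfl⟩ | ⟨g, h, hg, hgd, hh, hhd, rfl⟩ :=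
    hm.irreducible_or_eq_of_natDegree_four hd
  · exact ⟨_, .inl dvd_rfl, exists_dvd_X_pow_sub_of_irreducible hq hm hd h0 hf⟩
  · exact ⟨_, .inr (.inl dvd_rfl), exists_linear_mul_cubic_dvd_X_pow_sub hq hg hgd hgi
      (by simpa [mul_coeff_zero] using h0)⟩
  · exact exists_quadratic_mul_quadratic_dvd_X_pow_sub hq hp hg hgd hh hhd
      (by rwa [mul_coeff_zero] at h0)

lemma orderOf_mk_mem_bound (hq : Fintype.card F = q) (hp : 3 ≤ p)
    (g : Matrix.SpecialLinearGroup (Fin 4) F) :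
    DvdSpectrumBound p q (orderOf (g : PSL(4, F))) := by
  have h0 : g.1.charpoly.coeff 0 = 1 := by
    have := Matrix.det_eq_sign_charpoly_coeff g.1
    rw [g.2, Fintype.card_fin, (by decide : Even 4).neg_one_pow, one_mul] at this
    exact this.symm
  obtain ⟨n, hn, c, hc⟩ := exists_dvd_X_pow_sub hq hp g.1.charpoly_monic
    (by simp [Matrix.charpoly_natDegree_eq_dim]) h0
  have hg : g.1 ^ n = Matrix.scalar (Fin 4) c := by
    obtain ⟨r, hr⟩ := hc
    have := congrArg (aeval g.1) hr
    rw [map_mul, Matrix.aeval_self_charpoly, zero_mul, map_sub, map_pow, aeval_X, aeval_C,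
      sub_eq_zero] at this
    exact this
  have hcen : g ^ n ∈ Subgroup.center (Matrix.SpecialLinearGroup (Fin 4) F) := by
    refine Matrix.SpecialLinearGroup.mem_center_iff.2 ⟨c, ?_, ?_⟩
    · have h1 := congrArg Matrix.det hg
      rw [Matrix.det_pow, g.2, one_pow] at h1
      simpa using h1.symm
    · rw [← hg, Matrix.SpecialLinearGroup.coe_pow]
  have hdvd : orderOf (g : PSL(4, F)) ∣ n := by
    apply orderOf_dvd_of_pow_eq_one
    rw [← QuotientGroup.mk_pow]
    exact (QuotientGroup.eq_one_iff _).2 hcen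
  unfold DvdSpectrumBound at hn ⊢
  have key : ∀ k, n ∣ k → orderOf (g : PSL(4, F)) ∣ k := fun k hk => hdvd.trans hk
  exact hn.imp (key _) <| Or.imp (key _) <| Or.imp (key _) <| Or.imp (key _) <|
    Or.imp (key _) <| And.imp_right (key _)

end UpperBound

section LowerBound

variable {F : Type*} [Field F]

lemma exists_specialLinearGroup_pow_mem_center {f : F[X]} {n : ℕ} (hm : f.Monic)
    (hd : f.natDegree = 4) (h0 : f.coeff 0 = 1) (h : ∀ k c, f ∣ X ^ k - C c → n ∣ k) :
    ∃ g : Matrix.SpecialLinearGroup (Fin 4) F,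
      ∀ k, g ^ k ∈ Subgroup.center (Matrix.SpecialLinearGroup (Fin 4) F) → n ∣ k := by
  let pb := AdjoinRoot.powerBasis hm.ne_zero
  have hdim : pb.dim = 4 := hd
  let b := pb.basis.reindex (finCongr hdim)
  have hdet : (Algebra.leftMulMatrix b pb.gen).det = 1 := by
    rw [← Algebra.norm_eq_matrix_det, Algebra.PowerBasis.norm_gen_eq_coeff_zero_minpoly,
      AdjoinRoot.minpoly_powerBasis_gen_of_monic hm, h0, hdim]
    norm_num
  let g : Matrix.SpecialLinearGroup (Fin 4) F := ⟨Algebra.leftMulMatrix b pb.gen, hdet⟩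
  have hg : (g : Matrix (Fin 4) (Fin 4) F) = Algebra.leftMulMatrix b pb.gen := rfl
  refine ⟨g, fun k hk => ?_⟩
  obtain ⟨c, -, hc⟩ := Matrix.SpecialLinearGroup.mem_center_iff.1 hk
  refine h k c ?_
  rw [Matrix.SpecialLinearGroup.coe_pow, hg, ← map_pow] at hc
  have hc' := Algebra.leftMulMatrix_injective b
    (((Algebra.leftMulMatrix b).commutes c).trans hc)
  rw [← AdjoinRoot.mk_eq_zero, map_sub, sub_eq_zero, map_pow, AdjoinRoot.mk_X, AdjoinRoot.mk_C]
  exact hc'.symm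

lemma mem_specSet_of_dvd [Finite F] {f : F[X]} {n m : ℕ} (hm : f.Monic)
    (hd : f.natDegree = 4) (h0 : f.coeff 0 = 1) (h : ∀ k c, f ∣ X ^ k - C c → n ∣ k)
    (hmn : m ∣ n) : m ∈ specSet PSL(4, F) := by
  obtain ⟨g, hg⟩ := exists_specialLinearGroup_pow_mem_center hm hd h0 h
  have hn : n ∣ orderOf (g : PSL(4, F)) := hg _ <| by
    rw [← QuotientGroup.eq_one_iff, QuotientGroup.mk_pow, pow_orderOf_eq_one]
  exact ⟨_, orderOf_pow_orderOf_div (orderOf_pos _).ne' (hmn.trans hn)⟩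

lemma exists_monic_aeval_eq_zero {K : Type*} [Field K] [Algebra F K] [FiniteDimensional F K]
    (x : K) : ∃ f : F[X], f.Monic ∧ f.natDegree = Module.finrank F K ∧
      Algebra.norm F x = (-1) ^ Module.finrank F K * f.coeff 0 ∧ aeval x f = 0 := by
  refine ⟨(Algebra.lmul F K x).charpoly, LinearMap.charpoly_monic _,
    LinearMap.charpoly_natDegree _, LinearMap.det_eq_sign_charpoly_coeff _, ?_⟩
  have h := LinearMap.aeval_self_charpoly (Algebra.lmul F K x)
  rw [aeval_algHom_apply] at h
  exact (map_eq_zero_iff _ Algebra.lmul_injective).1 h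

lemma pow_eq_algebraMap_of_dvd {K : Type*} [Field K] [Algebra F K] {f : F[X]} {x : K} {k : ℕ}
    {c : F} (hx : aeval x f = 0) (h : f ∣ X ^ k - C c) : x ^ k = algebraMap F K c := by
  have := aeval_eq_zero_of_dvd_aeval_eq_zero h hx
  rwa [map_sub, map_pow, aeval_X, aeval_C, sub_eq_zero] at this

lemma pow_eq_of_mul_dvd {f : F[X]} {a c : F} {k : ℕ} (h : (X - C a) * f ∣ X ^ k - C c) :
    a ^ k = c :=
  X_sub_C_dvd_X_pow_sub_iff.1 (dvd_of_mul_right_dvd h)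

lemma char_dvd_of_sq_dvd {p : ℕ} [CharP F p] {a c : F} {k : ℕ} (ha : a ≠ 0)
    (h : (X - C a) ^ 2 ∣ X ^ k - C c) : p ∣ k := by
  have h1 := pow_sub_one_dvd_derivative_of_pow_dvd h
  rw [show 2 - 1 = 1 from rfl, pow_one, dvd_iff_isRoot, derivative_sub, derivative_X_pow,
    derivative_C, sub_zero, IsRoot.def, eval_mul, eval_C, eval_pow, eval_X] at h1
  exact (CharP.cast_eq_zero_iff F p k).1
    ((mul_eq_zero.1 h1).resolve_right (pow_ne_zero _ ha))

lemma sq_char_dvd_of_pow_dvd {p : ℕ} [Fact p.Prime] [CharP F p] {n k : ℕ} {c : F}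
    (hn : p < n) (h2 : 2 ≤ p) (h : (X - C 1) ^ n ∣ X ^ k - C c) : p ^ 2 ∣ k := by
  have hc := X_sub_C_dvd_X_pow_sub_iff.1 ((dvd_pow_self (X - C 1) (by omega)).trans h)
  rw [one_pow] at hc
  subst hc
  obtain ⟨j, rfl⟩ := char_dvd_of_sq_dvd (p := p) one_ne_zero ((pow_dvd_pow _ (by omega)).trans h)
  obtain ⟨g, hg⟩ : X - C (1 : F) ∣ X ^ j - C 1 := X_sub_C_dvd_X_pow_sub_iff.2 (one_pow j)
  have h1 : (X - C (1 : F)) ^ p * (X - C 1) ∣ (X - C 1) ^ p * g ^ p := by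
    rw [← pow_succ, ← mul_pow, ← hg, sub_pow_char (X ^ j) (C (1 : F)) (p := p), ← pow_mul,
      ← C_pow, one_pow, mul_comm j]
    exact (pow_dvd_pow _ hn).trans h
  have h3 : X - C 1 ∣ g := (prime_X_sub_C 1).dvd_of_dvd_pow
    ((mul_dvd_mul_iff_left (pow_ne_zero p (X_sub_C_ne_zero 1))).1 h1)
  rw [pow_two]
  refine mul_dvd_mul_left _ (char_dvd_of_sq_dvd (F := F) (a := 1) (c := 1) one_ne_zero ?_)
  rw [hg, pow_two]
  exact mul_dvd_mul_left _ h3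

variable [Fintype F] {p q : ℕ}

lemma exists_extension_generator (hq : Fintype.card F = q) (n : ℕ) [NeZero n] :
    ∃ (K : Type) (_ : Field K) (_ : Algebra F K) (_ : FiniteDimensional F K) (w : K),
      Module.finrank F K = n ∧ orderOf w = q ^ n - 1 ∧
      ∀ x : K, algebraMap F K (Algebra.norm F x) = x ^ ∑ i ∈ Finset.range n, q ^ i := by
  obtain ⟨p, _⟩ := CharP.exists F
  have : Fact p.Prime := ⟨CharP.char_is_prime F p⟩
  let K := FiniteField.Extension F p n
  have hfr : Module.finrank F K = n := FiniteField.finrank_extension F p n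
  obtain ⟨w, hw⟩ := IsCyclic.exists_ofOrder_eq_natCard (α := Kˣ)
  refine ⟨K, inferInstance, inferInstance, inferInstance, w, hfr, ?_, fun x => ?_⟩
  · rw [orderOf_units, hw, Nat.card_units, FiniteField.natCard_extension,
      Nat.card_eq_fintype_card, hq]
  · rw [FiniteField.algebraMap_norm_eq_pow_sum, hfr, Nat.card_eq_fintype_card, hq]

lemma pow_gcd_eq_one_of_pow_four (hq : Fintype.card F = q) {c : F} (hc : c ^ 4 = 1) :
    c ^ Nat.gcd 4 (q - 1) = 1 := by
  have hc0 : c ≠ 0 := by rintro rfl; simp at hc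
  exact pow_gcd_eq_one.2 ⟨hc, pow_sub_one_eq_one hq hc0⟩

lemma norm_ne_zero_of_orderOf {K : Type*} [Field K] [Algebra F K] [FiniteDimensional F K] {w : K}
    (hw : orderOf w ≠ 0) : Algebra.norm F w ≠ 0 := by
  rw [Algebra.norm_ne_zero_iff]
  rintro rfl
  exact hw (orderOf_eq_zero_iff'.2 fun n hn => by simp [hn.ne'])

lemma pow_sub_one_ne_zero (hq : Fintype.card F = q) {n : ℕ} (hn : n ≠ 0) : q ^ n - 1 ≠ 0 := by
  have := Nat.one_lt_pow hn (hq ▸ Fintype.one_lt_card : 1 < q)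
  omega

variable [Fact p.Prime] [CharP F p] {m : ℕ}

lemma mem_specSet_of_dvd_quartic (hq : Fintype.card F = q)
    (hm : m ∣ (q ^ 2 + 1) * (q + 1) / Nat.gcd 4 (q - 1)) : m ∈ specSet PSL(4, F) := by
  have hq1 : 1 < q := hq ▸ Fintype.one_lt_card
  obtain ⟨K, _, _, _, w, hfr, hw, hN⟩ := exists_extension_generator hq 4
  obtain ⟨f, hf, hfd, hf0, hfw⟩ := exists_monic_aeval_eq_zero (F := F) (w ^ (q - 1))
  have hq4 : q ^ 4 - 1 = (q - 1) * ((q ^ 2 + 1) * (q + 1)) := by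
    obtain ⟨r, rfl⟩ := Nat.exists_eq_add_of_lt hq1
    simp only [Nat.add_sub_cancel]
    rw [Nat.sub_eq_iff_eq_add (Nat.one_le_pow _ _ (by omega))]
    ring
  have hn : Algebra.norm F (w ^ (q - 1)) = 1 := by
    apply FaithfulSMul.algebraMap_injective F K
    have : ∑ i ∈ Finset.range 4, q ^ i = (q ^ 2 + 1) * (q + 1) := by
      simp only [Finset.sum_range_succ, Finset.sum_range_zero]
      ring
    rw [hN, ← pow_mul, this, ← hq4, ← hw, pow_orderOf_eq_one, map_one]
  rw [hn, hfr, (by decide : Even 4).neg_one_pow, one_mul] at hf0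
  refine mem_specSet_of_dvd hf (hfd.trans hfr) hf0.symm (fun k c h => ?_) hm
  have h1 := pow_eq_algebraMap_of_dvd hfw h
  have hc4 : c ^ 4 = 1 := by
    have := congrArg (Algebra.norm F) h1
    rw [Algebra.norm_algebraMap, hfr, map_pow, hn, one_pow] at this
    exact this.symm
  have h2 : w ^ ((q - 1) * (Nat.gcd 4 (q - 1) * k)) = 1 := by
    rw [mul_comm _ k, pow_mul, pow_mul, h1, ← map_pow, pow_gcd_eq_one_of_pow_four hq hc4, map_one]
  have h3 := orderOf_dvd_of_pow_eq_one h2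
  rw [hw, hq4] at h3
  exact (Nat.div_dvd_iff_dvd_mul (gcd_dvd_sq_add_one_mul hq1)
    (Nat.gcd_pos_of_pos_left _ (by norm_num))).2 (Nat.dvd_of_mul_dvd_mul_left (by omega) h3)

lemma mem_specSet_of_dvd_cubic (hq : Fintype.card F = q)
    (hm : m ∣ (q ^ 3 - 1) / Nat.gcd 4 (q - 1)) : m ∈ specSet PSL(4, F) := by
  have hq1 : 1 < q := hq ▸ Fintype.one_lt_card
  obtain ⟨K, _, _, _, w, hfr, hw, -⟩ := exists_extension_generator hq 3
  obtain ⟨f, hf, hfd, hf0, hfw⟩ := exists_monic_aeval_eq_zero (F := F) w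
  have hn0 := norm_ne_zero_of_orderOf (F := F) (hw ▸ pow_sub_one_ne_zero hq three_ne_zero)
  set N := Algebra.norm F w with hNdef
  rw [hfr] at hf0
  have hf0' : f.coeff 0 = -N := by rw [hf0]; ring
  refine mem_specSet_of_dvd ((monic_X_sub_C N⁻¹).mul hf) ?_ ?_ (fun k c h => ?_) hm
  · rw [(monic_X_sub_C _).natDegree_mul hf, natDegree_X_sub_C, hfd, hfr]
  · rw [mul_coeff_zero, hf0', coeff_sub, coeff_X_zero, coeff_C_zero, zero_sub, neg_mul_neg,
      inv_mul_cancel₀ hn0]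
  have h1 := pow_eq_algebraMap_of_dvd hfw (dvd_of_mul_left_dvd h)
  have h2 := pow_eq_of_mul_dvd h
  have hc4 : c ^ 4 = 1 := by
    have := congrArg (Algebra.norm F) h1
    rw [Algebra.norm_algebraMap, hfr, map_pow, ← hNdef] at this
    rw [pow_succ, ← this, ← h2, ← mul_pow, mul_inv_cancel₀ hn0, one_pow]
  have h3 : w ^ (Nat.gcd 4 (q - 1) * k) = 1 := by
    rw [mul_comm, pow_mul, h1, ← map_pow, pow_gcd_eq_one_of_pow_four hq hc4, map_one]
  have h4 := orderOf_dvd_of_pow_eq_one h3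
  rw [hw] at h4
  exact (Nat.div_dvd_iff_dvd_mul (gcd_dvd_cube_sub_one hq1)
    (Nat.gcd_pos_of_pos_left _ (by norm_num))).2 h4

lemma mem_specSet_of_dvd_quadratic (hq : Fintype.card F = q)
    (hm : m ∣ q ^ 2 - 1) : m ∈ specSet PSL(4, F) := by
  obtain ⟨K, _, _, _, w, hfr, hw, -⟩ := exists_extension_generator hq 2
  obtain ⟨f, hf, hfd, hf0, hfw⟩ := exists_monic_aeval_eq_zero (F := F) w
  have hn0 := norm_ne_zero_of_orderOf (F := F) (hw ▸ pow_sub_one_ne_zero hq two_ne_zero)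
  set N := Algebra.norm F w with hNdef
  rw [hfr, neg_one_sq, one_mul] at hf0
  have hg := (monic_X_sub_C (N⁻¹ ^ 2)).mul hf
  refine mem_specSet_of_dvd ((monic_X_sub_C N).mul hg) ?_ ?_ (fun k c h => ?_) hm
  · rw [(monic_X_sub_C _).natDegree_mul hg, (monic_X_sub_C _).natDegree_mul hf,
      natDegree_X_sub_C, natDegree_X_sub_C, hfd, hfr]
  · simp only [mul_coeff_zero, ← hf0, coeff_sub, coeff_X_zero, coeff_C_zero, zero_sub]
    field_simp
  have h1 := pow_eq_algebraMap_of_dvd hfw (dvd_of_mul_left_dvd (dvd_of_mul_left_dvd h))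
  have h2 := pow_eq_of_mul_dvd h
  have h3 := congrArg (Algebra.norm F) h1
  rw [Algebra.norm_algebraMap, hfr, map_pow, ← hNdef, h2, pow_two] at h3
  have hc0 : c ≠ 0 := h2 ▸ pow_ne_zero k hn0
  rw [← hw]
  exact orderOf_dvd_of_pow_eq_one (by rw [h1, (left_eq_mul₀ hc0).1 h3, map_one])

lemma exists_pow_four_eq_pow_gcd (hq : Fintype.card F = q) {a : F} (ha : a ≠ 0) :
    ∃ s, s ≠ 0 ∧ s ^ 4 = a ^ Nat.gcd 4 (q - 1) := by
  refine ⟨a ^ Nat.gcdA 4 (q - 1), zpow_ne_zero _ ha, ?_⟩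
  have h := Nat.gcd_eq_gcd_ab 4 (q - 1)
  rw [← zpow_natCast a, h, zpow_add₀ ha, zpow_mul a ((q - 1 : ℕ) : ℤ), zpow_natCast,
    pow_sub_one_eq_one hq ha, one_zpow, mul_one, mul_comm, zpow_mul]
  exact (zpow_natCast _ 4).symm

lemma coprime_char_sq_sub_one (hq : Fintype.card F = q) : p.Coprime (q ^ 2 - 1) := by
  have hp : p.Prime := Fact.out
  refine (Nat.Prime.coprime_iff_not_dvd hp).2 fun h => ?_
  have hpq : p ∣ q := (CharP.cast_eq_zero_iff F p q).1 (by rw [← hq, Nat.cast_card_eq_zero])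
  have h1 := (Nat.dvd_sub_iff_right (Nat.one_le_pow 2 q (hq ▸ Fintype.card_pos))
    (hpq.trans (dvd_pow_self q two_ne_zero))).1 h
  exact hp.one_lt.ne' (Nat.dvd_one.1 h1)

lemma mem_specSet_of_dvd_char_mul_quadratic (hq : Fintype.card F = q)
    (hm : m ∣ p * (q ^ 2 - 1) / Nat.gcd 4 (q - 1)) : m ∈ specSet PSL(4, F) := by
  obtain ⟨K, _, _, _, w, hfr, hw, -⟩ := exists_extension_generator hq 2
  have hn0 := norm_ne_zero_of_orderOf (F := F) (hw ▸ pow_sub_one_ne_zero hq two_ne_zero)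
  obtain ⟨s, hs0, hs⟩ := exists_pow_four_eq_pow_gcd hq hn0
  set d := Nat.gcd 4 (q - 1) with hd
  obtain ⟨f, hf, hfd, hf0, hfw⟩ :=
    exists_monic_aeval_eq_zero (F := F) (algebraMap F K s⁻¹ * w ^ d)
  rw [hfr, neg_one_sq, one_mul, map_mul, Algebra.norm_algebraMap, hfr, map_pow, ← hs] at hf0
  have hX := (monic_X_sub_C s⁻¹).pow 2
  refine mem_specSet_of_dvd (hX.mul hf) ?_ ?_ (fun k c h => ?_) hm
  · rw [hX.natDegree_mul hf, (monic_X_sub_C _).natDegree_pow, natDegree_X_sub_C, hfd, hfr]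
  · rw [mul_coeff_zero, ← hf0, coeff_zero_eq_eval_zero, eval_pow, eval_sub, eval_X, eval_C]
    field_simp
    ring
  have h1 := pow_eq_algebraMap_of_dvd hfw (dvd_of_mul_left_dvd h)
  have h2 : s⁻¹ ^ k = c := X_sub_C_dvd_X_pow_sub_iff.1
    ((dvd_pow_self _ two_ne_zero).trans (dvd_of_mul_right_dvd h))
  have hpk : p ∣ k := char_dvd_of_sq_dvd (inv_ne_zero hs0) (dvd_of_mul_right_dvd h)
  rw [mul_pow, ← map_pow, h2] at h1
  have hc0 : algebraMap F K c ≠ 0 := by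
    rw [Ne, map_eq_zero, ← h2]
    exact pow_ne_zero k (inv_ne_zero hs0)
  have h3 := orderOf_dvd_of_pow_eq_one ((pow_mul w d k).trans ((mul_eq_left₀ hc0).1 h1))
  rw [hw] at h3
  have hdq : d ∣ q ^ 2 - 1 := gcd_dvd_sq_sub_one
  rw [Nat.mul_div_assoc _ hdq]
  refine Nat.Coprime.mul_dvd_of_dvd_of_dvd
    ((coprime_char_sq_sub_one (F := F) hq).coprime_dvd_right (Nat.div_dvd_of_dvd hdq)) hpk ?_
  exact (Nat.div_dvd_iff_dvd_mul hdq (Nat.gcd_pos_of_pos_left _ (by norm_num))).2 h3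

lemma mem_specSet_of_dvd_char_mul_linear (hq : Fintype.card F = q)
    (hm : m ∣ p * (q - 1)) : m ∈ specSet PSL(4, F) := by
  obtain ⟨w, hw⟩ := IsCyclic.exists_ofOrder_eq_natCard (α := Fˣ)
  rw [Nat.card_units, Nat.card_eq_fintype_card, hq, ← orderOf_units] at hw
  have hX := (monic_X_sub_C (1 : F)).pow 2
  have hw1 := monic_X_sub_C (w : F)
  have hw2 := monic_X_sub_C (w : F)⁻¹
  refine mem_specSet_of_dvd (hw1.mul (hw2.mul hX)) ?_ ?_ (fun k c h => ?_) hm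
  · rw [hw1.natDegree_mul (hw2.mul hX), hw2.natDegree_mul hX, (monic_X_sub_C _).natDegree_pow,
      natDegree_X_sub_C, natDegree_X_sub_C, natDegree_X_sub_C]
  · rw [coeff_zero_eq_eval_zero]
    simp
  have h1 := pow_eq_of_mul_dvd h
  have hs := dvd_of_mul_left_dvd (dvd_of_mul_left_dvd h)
  have h2 := X_sub_C_dvd_X_pow_sub_iff.1 ((dvd_pow_self _ two_ne_zero).trans hs)
  rw [one_pow] at h2
  have h3 := orderOf_dvd_of_pow_eq_one (h1.trans h2.symm)
  rw [hw] at h3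
  have h4 := Nat.sq_sub_sq q 1
  rw [one_pow] at h4
  refine Nat.Coprime.mul_dvd_of_dvd_of_dvd ((coprime_char_sq_sub_one (F := F) hq).coprime_dvd_right
    (h4 ▸ dvd_mul_left _ _)) (char_dvd_of_sq_dvd one_ne_zero hs) h3

lemma mem_specSet_of_dvd_nine [CharP F 3] (hm : m ∣ 9) : m ∈ specSet PSL(4, F) := by
  have : Fact (Nat.Prime 3) := ⟨Nat.prime_three⟩
  refine mem_specSet_of_dvd ((monic_X_sub_C (1 : F)).pow 4) ?_ ?_
    (fun k c h => sq_char_dvd_of_pow_dvd (F := F) (p := 3) (by norm_num) (by norm_num) h) hm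
  · rw [(monic_X_sub_C _).natDegree_pow, natDegree_X_sub_C]
  · rw [coeff_zero_eq_eval_zero, eval_pow, eval_sub, eval_X, eval_C]
    norm_num

end LowerBound

theorem spectrum_psl4
    (p f q : ℕ) (hp : p.Prime) (hpodd : Odd p) (hf : 0 < f) (hq : q = p ^ f)
    (F : Type*) [Field F] [Fintype F] (hF : Fintype.card F = q)
    (m : ℕ) (hm : 0 < m) :
    m ∈ specSet PSL(4, F) ↔
      (m ∣ (q ^ 2 + 1) * (q + 1) / Nat.gcd 4 (q - 1) ∨
       m ∣ (q ^ 3 - 1) / Nat.gcd 4 (q - 1) ∨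
       m ∣ q ^ 2 - 1 ∨
       m ∣ p * (q ^ 2 - 1) / Nat.gcd 4 (q - 1) ∨
       m ∣ p * (q - 1) ∨
       (p = 3 ∧ m ∣ 9)) := by
  have : Fact p.Prime := ⟨hp⟩
  have : CharP F p := charP_of_card_eq_prime_pow (hF.trans hq)
  have hp3 : 3 ≤ p := by
    obtain ⟨r, rfl⟩ := hpodd
    have := hp.two_le
    omega
  constructor
  · rintro ⟨x, rfl⟩
    obtain ⟨g, rfl⟩ := QuotientGroup.mk_surjective x
    exact orderOf_mk_mem_bound hF hp3 g
  · rintro (h | h | h | h | h | ⟨rfl, h⟩)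
    · exact mem_specSet_of_dvd_quartic hF h
    · exact mem_specSet_of_dvd_cubic hF h
    · exact mem_specSet_of_dvd_quadratic hF h
    · exact mem_specSet_of_dvd_char_mul_quadratic hF h
    · exact mem_specSet_of_dvd_char_mul_linear hF h
    · exact mem_specSet_of_dvd_nine h
end

section
/- Let q = p^f be a power of an odd prime p and let L = PSL(4, 𝔽_q). Then the least common multiple of the orders of elements of L that are coprime to p equals (q⁴−1)(q²+q+1)/2; that is, exp_{p'}(L) = (q⁴−1)(q²+q+1)/2. -/
open scoped MatrixGroups

open Polynomial in
lemma Irreducible.dvd_X_pow_natCard_pow_sub_one {F : Type*} [Field F] [Finite F] {g : F[X]}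
    (hg : Irreducible g) (h0 : g.coeff 0 ≠ 0) :
    g ∣ X ^ (Nat.card F ^ g.natDegree - 1) - 1 := by
  have := Fact.mk hg
  have := (AdjoinRoot.powerBasis hg.ne_zero).finite
  have : Finite (AdjoinRoot g) := Module.finite_of_finite F
  have := Fintype.ofFinite (AdjoinRoot g)
  have hroot : AdjoinRoot.root g ≠ 0 := by
    intro h
    have := AdjoinRoot.eval₂_root g
    rw [h, eval₂_at_zero] at this
    exact h0 ((map_eq_zero _).1 this)
  have hcard : Nat.card (AdjoinRoot g) = Nat.card F ^ g.natDegree := by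
    rw [Module.natCard_eq_pow_finrank (K := F), (AdjoinRoot.powerBasis hg.ne_zero).finrank,
      AdjoinRoot.powerBasis_dim]
  rw [← AdjoinRoot.mk_eq_zero, ← hcard, Nat.card_eq_fintype_card]
  simpa [sub_eq_zero] using FiniteField.pow_card_sub_one_eq_one _ hroot

open Polynomial in
lemma Irreducible.dvd_X_pow_sum_sub_one {F : Type*} [Field F] [Finite F] {g : F[X]}
    (hg : Irreducible g) (hm : g.Monic) (h0 : g.coeff 0 = (-1) ^ g.natDegree) :
    g ∣ X ^ (∑ i ∈ Finset.range g.natDegree, Nat.card F ^ i) - 1 := by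
  have := Fact.mk hg
  have hfin := (AdjoinRoot.powerBasis hg.ne_zero).finite
  have : Finite (AdjoinRoot g) := Module.finite_of_finite F
  have hnorm : Algebra.norm F (AdjoinRoot.root g) = 1 := by
    have := Algebra.PowerBasis.norm_gen_eq_coeff_zero_minpoly (AdjoinRoot.powerBasis hg.ne_zero)
    rwa [AdjoinRoot.minpoly_powerBasis_gen_of_monic hm, AdjoinRoot.powerBasis_gen,
      AdjoinRoot.powerBasis_dim, h0, ← mul_pow, neg_one_mul, neg_neg, one_pow] at this
  have := FiniteField.algebraMap_norm_eq_pow_sum F (AdjoinRoot g) (AdjoinRoot.root g)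
  rw [hnorm, map_one, (AdjoinRoot.powerBasis hg.ne_zero).finrank, AdjoinRoot.powerBasis_dim] at this
  rw [← AdjoinRoot.mk_eq_zero]
  simp [← this]

open Polynomial in
lemma Polynomial.exists_dvd_pow_of_irreducible_dvd {F : Type*} [Field F] {P Q : F[X]}
    (hP : P ≠ 0) (h : ∀ g, Irreducible g → g ∣ P → g ∣ Q) : ∃ k, P ∣ Q ^ k := by
  classical
  refine ⟨(UniqueFactorizationMonoid.normalizedFactors P).card, ?_⟩
  refine (UniqueFactorizationMonoid.prod_normalizedFactors hP).symm.dvd.trans ?_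
  rw [← Multiset.prod_replicate, ← Multiset.map_const']
  conv_lhs => rw [← Multiset.map_id (UniqueFactorizationMonoid.normalizedFactors P)]
  exact Multiset.prod_dvd_prod_of_dvd _ _ fun g hg =>
    h g (UniqueFactorizationMonoid.irreducible_of_normalized_factor g hg)
      (UniqueFactorizationMonoid.dvd_of_mem_normalizedFactors hg)

/-- If every irreducible factor of the characteristic polynomial divides `X ^ N - 1`, then
the order of the matrix divides `N` up to a power of the characteristic. -/
lemma Matrix.exists_pow_mul_pow_char_eq_one {F : Type*} [Field F] (p : ℕ) [Fact p.Prime]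
    [CharP F p] {n : Type*} [Fintype n] [DecidableEq n] [Nonempty n] (A : Matrix n n F) (N : ℕ)
    (h : ∀ g, Irreducible g → g ∣ A.charpoly → g ∣ (Polynomial.X ^ N - 1 : Polynomial F)) :
    ∃ k, A ^ (N * p ^ k) = 1 := by
  obtain ⟨k, hk⟩ := Polynomial.exists_dvd_pow_of_irreducible_dvd A.charpoly_monic.ne_zero h
  refine ⟨k, ?_⟩
  have h0 : (A ^ N - 1) ^ k = 0 := by
    obtain ⟨c, hc⟩ := hk
    simpa [A.aeval_self_charpoly] using congrArg (Polynomial.aeval A) hc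
  have h1 : (A ^ N - 1) ^ p ^ k = 0 :=
    pow_eq_zero_of_le (Nat.lt_pow_self (Fact.out : p.Prime).one_lt).le h0
  rwa [sub_pow_char_pow_of_commute _ _ (Commute.one_right _), one_pow, sub_eq_zero, ← pow_mul] at h1

lemma dvd_psl4_exponent {q d : ℕ} (hq : Odd q) (h : d ∈ ({q ^ 1 - 1, q ^ 2 - 1, q ^ 3 - 1,
    ∑ i ∈ Finset.range 4, q ^ i} : Set ℕ)) : d ∣ (q ^ 4 - 1) * (q ^ 2 + q + 1) / 2 := by
  obtain ⟨n, rfl⟩ := hq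
  have e : ((2 * n + 1) ^ 4 - 1) * ((2 * n + 1) ^ 2 + (2 * n + 1) + 1) / 2 =
      n * (2 * n + 2) * ((2 * n + 1) ^ 2 + 1) * ((2 * n + 1) ^ 2 + (2 * n + 1) + 1) := by
    apply Nat.div_eq_of_eq_mul_right two_pos
    rw [← mul_assoc]
    congr 1
    apply Nat.sub_eq_of_eq_add
    ring
  rw [e]
  simp only [Set.mem_insert_iff, Set.mem_singleton_iff] at h
  have e1 : (2 * n + 1) ^ 1 - 1 = 2 * n := by simp
  have e2 : (2 * n + 1) ^ 2 - 1 = 2 * n * (2 * n + 2) := Nat.sub_eq_of_eq_add (by ring)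
  have e3 : (2 * n + 1) ^ 3 - 1 = 2 * n * ((2 * n + 1) ^ 2 + (2 * n + 1) + 1) :=
    Nat.sub_eq_of_eq_add (by ring)
  rw [e1, e2, e3] at h
  obtain rfl | rfl | rfl | rfl := h
  · exact ⟨(n + 1) * ((2 * n + 1) ^ 2 + 1) * ((2 * n + 1) ^ 2 + (2 * n + 1) + 1), by ring⟩
  · exact ⟨(2 * n ^ 2 + 2 * n + 1) * ((2 * n + 1) ^ 2 + (2 * n + 1) + 1), by ring⟩
  · exact ⟨(n + 1) * ((2 * n + 1) ^ 2 + 1), by ring⟩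
  · exact ⟨n * ((2 * n + 1) ^ 2 + (2 * n + 1) + 1), by simp [Finset.sum_range_succ]; ring⟩

open Polynomial in
lemma Matrix.SpecialLinearGroup.exists_pow_psl4_exponent_mul_eq_one {F : Type*} [Field F]
    [Finite F] (p : ℕ) [Fact p.Prime] [CharP F p] (hF : Odd (Nat.card F))
    (A : Matrix.SpecialLinearGroup (Fin 4) F) :
    ∃ k, A ^ ((Nat.card F ^ 4 - 1) * (Nat.card F ^ 2 + Nat.card F + 1) / 2 * p ^ k) = 1 := by
  set P := A.1.charpoly with hP
  have hdeg : P.natDegree = 4 := by simp [hP, Matrix.charpoly_natDegree_eq_dim]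
  have hm : P.Monic := A.1.charpoly_monic
  have h0 : P.coeff 0 = 1 := by
    have := A.1.det_eq_sign_charpoly_coeff
    rw [A.2] at this
    simpa [← hP, Even.neg_one_pow (show Even 4 by decide)] using this.symm
  have key {d : ℕ} (h : d ∈ ({Nat.card F ^ 1 - 1, Nat.card F ^ 2 - 1, Nat.card F ^ 3 - 1,
      ∑ i ∈ Finset.range 4, Nat.card F ^ i} : Set ℕ)) :
      (X ^ d - 1 : F[X]) ∣
        X ^ ((Nat.card F ^ 4 - 1) * (Nat.card F ^ 2 + Nat.card F + 1) / 2) - 1 := by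
    obtain ⟨c, hc⟩ := dvd_psl4_exponent hF h
    rw [hc, pow_mul]
    simpa using sub_dvd_pow_sub_pow (X ^ d : F[X]) 1 c
  obtain ⟨k, hk⟩ := Matrix.exists_pow_mul_pow_char_eq_one p A.1
    ((Nat.card F ^ 4 - 1) * (Nat.card F ^ 2 + Nat.card F + 1) / 2) fun g hg hgP => by
      have hle : g.natDegree ≤ 4 := hdeg ▸ natDegree_le_of_dvd hgP hm.ne_zero
      have hg0 : g.coeff 0 ≠ 0 := by
        obtain ⟨c, hc⟩ := hgP
        intro h
        rw [← hP] at hc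
        simp [hc, h] at h0
      have hpos := hg.natDegree_pos
      have h1 := hg.dvd_X_pow_natCard_pow_sub_one hg0
      obtain h | h | h | h : g.natDegree = 1 ∨ g.natDegree = 2 ∨ g.natDegree = 3 ∨
        g.natDegree = 4 := by omega
      · exact (h ▸ h1).trans (key (by simp))
      · exact (h ▸ h1).trans (key (by simp))
      · exact (h ▸ h1).trans (key (by simp))
      · have ha : Associated g P :=
          associated_of_dvd_of_natDegree_le hgP hm.ne_zero (hdeg.trans h.symm).le
        have h2 := (ha.irreducible hg).dvd_X_pow_sum_sub_one hm
          (by rw [h0, hdeg, Even.neg_one_pow (by decide)])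
        rw [hdeg] at h2
        exact ha.dvd.trans (h2.trans (key (by simp)))
  exact ⟨k, Subtype.ext (by simpa using hk)⟩

lemma orderOf_dvd_psl4_exponent {F : Type*} [Field F] [Finite F] (p : ℕ) [Fact p.Prime]
    [CharP F p] (hF : Odd (Nat.card F)) (g : PSL(4, F)) (hg : (orderOf g).Coprime p) :
    orderOf g ∣ (Nat.card F ^ 4 - 1) * (Nat.card F ^ 2 + Nat.card F + 1) / 2 := by
  obtain ⟨A, rfl⟩ := QuotientGroup.mk_surjective g
  obtain ⟨k, hk⟩ := A.exists_pow_psl4_exponent_mul_eq_one p hF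
  refine (hg.pow_right k).dvd_of_dvd_mul_right (orderOf_dvd_of_pow_eq_one ?_)
  rw [← QuotientGroup.mk_pow, hk, QuotientGroup.mk_one]

lemma Algebra.norm_prod_mk {F R S : Type*} [Field F] [CommRing R] [CommRing S] [Algebra F R]
    [Algebra F S] [Module.Finite F R] [Module.Finite F S] (x : R) (y : S) :
    Algebra.norm F (x, y) = Algebra.norm F x * Algebra.norm F y := by
  simp only [Algebra.norm_apply, ← LinearMap.det_prodMap]
  rfl

/-- An element of norm one of a `4`-dimensional commutative algebra gives an element of
`PSL(4, F)`, whose order annihilates it modulo the fourth roots of unity of `F`. -/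
lemma exists_pow_eq_algebraMap_of_norm_eq_one {F R : Type*} [Field F] [CommRing R] [Algebra F R]
    (hR : Module.finrank F R = 4) {p d : ℕ}
    (hd : ∀ m ∈ specSet PSL(4, F), Nat.Coprime m p → m ∣ d)
    {x : R} (hx : Algebra.norm F x = 1) {e : ℕ} (he : e.Coprime p) (hxe : x ^ e = 1) :
    ∃ r : F, r ^ 4 = 1 ∧ x ^ d = algebraMap F R r := by
  have : Module.Finite F R := Module.finite_of_finrank_pos (by omega)
  let b := Module.finBasisOfFinrankEq F R hR
  let A : Matrix.SpecialLinearGroup (Fin 4) F :=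
    ⟨Algebra.leftMulMatrix b x, by rw [← Algebra.norm_eq_matrix_det, hx]⟩
  have hA (k : ℕ) : (A ^ k).1 = Algebra.leftMulMatrix b (x ^ k) := by
    rw [Matrix.SpecialLinearGroup.coe_pow, map_pow]
  have hord : orderOf (A : PSL(4, F)) ∣ e := by
    apply orderOf_dvd_of_pow_eq_one
    rw [← QuotientGroup.mk_pow, show A ^ e = 1 from Subtype.ext (by rw [hA, hxe]; simp),
      QuotientGroup.mk_one]
  have hpow := orderOf_dvd_iff_pow_eq_one.1 (hd _ ⟨_, rfl⟩ (he.coprime_dvd_left hord))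
  rw [← QuotientGroup.mk_pow, QuotientGroup.eq_one_iff,
    Matrix.SpecialLinearGroup.mem_center_iff] at hpow
  obtain ⟨r, hr, hrA⟩ := hpow
  refine ⟨r, by simpa using hr, Algebra.leftMulMatrix_injective b ?_⟩
  rw [← hA, ← hrA, AlgHom.commutes]
  rfl

lemma FiniteField.exists_orderOf_eq_natCard_pow_sub_one (F : Type*) [Field F] [Finite F]
    (p : ℕ) [Fact p.Prime] [CharP F p] (n : ℕ) [NeZero n] :
    ∃ x : FiniteField.Extension F p n, x ≠ 0 ∧ orderOf x = Nat.card F ^ n - 1 := by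
  obtain ⟨u, hu⟩ := IsCyclic.exists_generator (α := (FiniteField.Extension F p n)ˣ)
  refine ⟨u, u.ne_zero, ?_⟩
  rw [orderOf_units, orderOf_eq_card_of_forall_mem_zpowers hu, Nat.card_units,
    FiniteField.natCard_extension]

section Divisibility

variable {F : Type*} [Field F] [Finite F] {p d : ℕ} [Fact p.Prime] [CharP F p]

lemma FiniteField.coprime_natCard_pow_sub_one (F : Type*) [Field F] [Finite F] (p : ℕ)
    [Fact p.Prime] [CharP F p] {n : ℕ} (hn : n ≠ 0) : (Nat.card F ^ n - 1).Coprime p := by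
  have h : (Nat.card F ^ n - 1).Coprime (Nat.card F ^ n) :=
    (Nat.coprime_self_sub_left (Nat.one_le_pow _ _ Nat.card_pos)).2 (Nat.coprime_one_left _)
  refine h.coprime_dvd_right (dvd_pow ?_ hn)
  have := Fintype.ofFinite F
  rw [← CharP.cast_eq_zero_iff F p, Nat.card_eq_fintype_card, Nat.cast_card_eq_zero]

lemma natCard_sq_sub_one_dvd (hd : ∀ m ∈ specSet PSL(4, F), Nat.Coprime m p → m ∣ d) :
    Nat.card F ^ 2 - 1 ∣ d := by
  obtain ⟨x, hx0, hx⟩ := FiniteField.exists_orderOf_eq_natCard_pow_sub_one F p 2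
  have hN : Algebra.norm F x ≠ 0 := (Algebra.norm_ne_zero_iff).2 hx0
  have hfin := FiniteField.finrank_extension F p 2
  obtain ⟨r, -, hr⟩ := exists_pow_eq_algebraMap_of_norm_eq_one
    (R := FiniteField.Extension F p 2 × F × F) (by simp [hfin]) hd
    (x := (x, (Algebra.norm F x)⁻¹, 1))
    (by simp [Algebra.norm_prod_mk, Algebra.norm_self, hN])
    (FiniteField.coprime_natCard_pow_sub_one F p two_ne_zero)
    (by
      have h1 : x ^ (Nat.card F ^ 2 - 1) = 1 := hx ▸ pow_orderOf_eq_one x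
      simp [h1, ← map_pow])
  simp only [Prod.ext_iff, Prod.pow_mk, one_pow, Prod.algebraMap_apply] at hr
  obtain ⟨hr1, -, hr2⟩ := hr
  rw [← hx]
  apply orderOf_dvd_of_pow_eq_one
  rw [hr1, show r = 1 from hr2.symm, map_one]

lemma natCard_cube_sub_one_dvd (hd : ∀ m ∈ specSet PSL(4, F), Nat.Coprime m p → m ∣ d) :
    Nat.card F ^ 3 - 1 ∣ 4 * d := by
  obtain ⟨x, hx0, hx⟩ := FiniteField.exists_orderOf_eq_natCard_pow_sub_one F p 3
  have hN : Algebra.norm F x ≠ 0 := (Algebra.norm_ne_zero_iff).2 hx0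
  have hfin := FiniteField.finrank_extension F p 3
  obtain ⟨r, hr4, hr⟩ := exists_pow_eq_algebraMap_of_norm_eq_one
    (R := FiniteField.Extension F p 3 × F) (by simp [hfin]) hd
    (x := (x, (Algebra.norm F x)⁻¹))
    (by simp [Algebra.norm_prod_mk, Algebra.norm_self, hN])
    (FiniteField.coprime_natCard_pow_sub_one F p three_ne_zero)
    (by
      have h1 : x ^ (Nat.card F ^ 3 - 1) = 1 := hx ▸ pow_orderOf_eq_one x
      simp [h1, ← map_pow])
  simp only [Prod.ext_iff, Prod.pow_mk, Prod.algebraMap_apply] at hr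
  rw [← hx]
  apply orderOf_dvd_of_pow_eq_one
  rw [mul_comm, pow_mul, hr.1, ← map_pow, hr4, map_one]

lemma natCard_pow_four_sub_one_dvd (hd : ∀ m ∈ specSet PSL(4, F), Nat.Coprime m p → m ∣ d) :
    Nat.card F ^ 4 - 1 ∣ (Nat.card F - 1) * (4 * d) := by
  have := Fintype.ofFinite F
  obtain ⟨x, hx0, hx⟩ := FiniteField.exists_orderOf_eq_natCard_pow_sub_one F p 4
  have hN : Algebra.norm F x ≠ 0 := (Algebra.norm_ne_zero_iff).2 hx0
  obtain ⟨r, hr4, hr⟩ := exists_pow_eq_algebraMap_of_norm_eq_one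
    (FiniteField.finrank_extension F p 4) hd (x := x ^ (Nat.card F - 1))
    (by rw [map_pow, Nat.card_eq_fintype_card, FiniteField.pow_card_sub_one_eq_one _ hN])
    (FiniteField.coprime_natCard_pow_sub_one F p four_ne_zero)
    (by rw [pow_right_comm, ← hx, pow_orderOf_eq_one, one_pow])
  rw [← hx]
  apply orderOf_dvd_of_pow_eq_one
  rw [mul_comm 4, pow_mul, pow_mul, hr, ← map_pow, hr4, map_one]

end Divisibility

lemma psl4_exponent_dvd {q d : ℕ} (hq : Odd q) (h2 : q ^ 2 - 1 ∣ d) (h3 : q ^ 3 - 1 ∣ 4 * d)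
    (h4 : q ^ 4 - 1 ∣ (q - 1) * (4 * d)) (hq1 : 1 < q) :
    (q ^ 4 - 1) * (q ^ 2 + q + 1) / 2 ∣ d := by
  obtain ⟨n, rfl⟩ := hq
  have hn : 0 < n := by omega
  have e : ((2 * n + 1) ^ 4 - 1) * ((2 * n + 1) ^ 2 + (2 * n + 1) + 1) / 2 =
      (2 * n ^ 2 + 2 * n + 1) *
        ((4 * n ^ 2 + 6 * n + 3) * ((2 * n) * (2 * n + 2))) := by
    apply Nat.div_eq_of_eq_mul_right two_pos
    rw [show (2 * n + 1) ^ 4 - 1 = 4 * n * (n + 1) * (2 * (2 * n ^ 2 + 2 * n + 1)) from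
      Nat.sub_eq_of_eq_add (by ring)]
    ring
  have e2 : (2 * n + 1) ^ 2 - 1 = 2 * n * (2 * n + 2) := Nat.sub_eq_of_eq_add (by ring)
  have e3 : (2 * n + 1) ^ 3 - 1 = 2 * n * (4 * n ^ 2 + 6 * n + 3) :=
    Nat.sub_eq_of_eq_add (by ring)
  have e4 : (2 * n + 1) ^ 4 - 1 = 2 * n * ((2 * n ^ 2 + 2 * n + 1) * (4 * (n + 1))) :=
    Nat.sub_eq_of_eq_add (by ring)
  rw [e2] at h2
  rw [e3] at h3
  rw [e4, Nat.add_sub_cancel] at h4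
  have h4' : 2 * n ^ 2 + 2 * n + 1 ∣ 4 * d :=
    (dvd_mul_right _ _).trans (Nat.dvd_of_mul_dvd_mul_left (by omega) h4)
  have hu2 : IsCoprime (2 * n ^ 2 + 2 * n + 1 : ℤ) 2 := ⟨1, -(n ^ 2 + n), by ring⟩
  have hs2 : IsCoprime (4 * n ^ 2 + 6 * n + 3 : ℤ) 2 := ⟨1, -(2 * n ^ 2 + 3 * n + 1), by ring⟩
  have hut : IsCoprime (2 * n ^ 2 + 2 * n + 1 : ℤ) (2 * n * (2 * n + 2)) :=
    ⟨2 * n ^ 2 + 2 * n + 1, -(n ^ 2 + n + 1), by ring⟩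
  have hus : IsCoprime (2 * n ^ 2 + 2 * n + 1 : ℤ) (4 * n ^ 2 + 6 * n + 3) :=
    ⟨2 + 2 * (2 * n + 1), -(2 * n + 1), by ring⟩
  have hsq : IsCoprime (4 * n ^ 2 + 6 * n + 3 : ℤ) (2 * n + 2) := ⟨1, -(2 * n + 1), by ring⟩
  rw [e]
  zify at h2 h3 h4' hn ⊢
  refine (hus.mul_right hut).mul_dvd ?_ ?_
  · exact (hu2.mul_right hu2).dvd_of_dvd_mul_left (by simpa using h4')
  · obtain ⟨c, hc⟩ := h2
    rw [hc] at h3 ⊢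
    rw [mul_comm]
    refine mul_dvd_mul_left _ (((hs2.mul_right hs2).mul_right hsq).dvd_of_dvd_mul_left ?_)
    refine Int.dvd_of_mul_dvd_mul_left (a := 2 * n) (by omega) (h3.trans (dvd_of_eq (by ring)))

theorem exp_p'_psl4
    (p f q : ℕ) (hp : p.Prime) (hpodd : Odd p) (hf : 0 < f) (hq : q = p ^ f)
    (F : Type*) [Field F] [Fintype F] (hF : Fintype.card F = q) :
    (∀ m ∈ specSet PSL(4, F), Nat.Coprime m p → m ∣ (q ^ 4 - 1) * (q ^ 2 + q + 1) / 2) ∧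
    (∀ d : ℕ, (∀ m ∈ specSet PSL(4, F), Nat.Coprime m p → m ∣ d) →
      (q ^ 4 - 1) * (q ^ 2 + q + 1) / 2 ∣ d) := by
  have := Fact.mk hp
  have : CharP F p := charP_of_card_eq_prime_pow (hF.trans hq)
  have hcard : Nat.card F = q := Nat.card_eq_fintype_card.trans hF
  have hodd : Odd q := hq ▸ hpodd.pow
  subst hcard
  refine ⟨?_, fun d hd => ?_⟩
  · rintro _ ⟨g, rfl⟩ hg
    exact orderOf_dvd_psl4_exponent p hodd g hg
  · exact psl4_exponent_dvd hodd (natCard_sq_sub_one_dvd hd) (natCard_cube_sub_one_dvd hd)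
      (natCard_pow_four_sub_one_dvd hd) Finite.one_lt_card
end

section
/- There exists a finite nonsolvable group G such that ω(G) = ω(A₁₀), where A₁₀ is the alternating group on 10 letters, and the solvable radical of G is not nilpotent. -/
/-! ### Solvable radicals -/

theorem isSolvable_sup {G : Type*} [Group G] (M N : Subgroup G) [M.Normal]
    [Group.IsSolvable M] [Group.IsSolvable N] : Group.IsSolvable (M ⊔ N : Subgroup G) := by
  let g : (M ⊔ N : Subgroup G) →* N.map (QuotientGroup.mk' M) :=
    ((QuotientGroup.mk' M).comp (M ⊔ N).subtype).codRestrict _ fun x => by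
      have hx : QuotientGroup.mk' M x ∈ (M ⊔ N).map (QuotientGroup.mk' M) :=
        Subgroup.mem_map_of_mem _ x.2
      rwa [Subgroup.map_sup, QuotientGroup.map_mk'_self, bot_sup_eq] at hx
  have : Group.IsSolvable (N.map (QuotientGroup.mk' M)) :=
    Group.isSolvable_of_surjective ((QuotientGroup.mk' M).subgroupMap_surjective N)
  refine Group.isSolvable_of_ker_le_range (Subgroup.inclusion (le_sup_left : M ≤ M ⊔ N)) g ?_
  intro x hx
  have hxM : (x : G) ∈ M := by
    rw [← QuotientGroup.eq_one_iff]
    exact congrArg Subtype.val (MonoidHom.mem_ker.mp hx)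
  exact ⟨⟨x, hxM⟩, rfl⟩

theorem exists_normal_isSolvable_forall_le (G : Type*) [Group G] [Finite G] :
    ∃ K : Subgroup G, K.Normal ∧ Group.IsSolvable K ∧
      ∀ N : Subgroup G, N.Normal → Group.IsSolvable N → N ≤ K := by
  obtain ⟨K, ⟨hK, hKs⟩, hmax⟩ :=
    (Set.toFinite {K : Subgroup G | K.Normal ∧ Group.IsSolvable K}).exists_maximal
      ⟨⊥, inferInstance, inferInstance⟩
  refine ⟨K, hK, hKs, fun N hN hNs => ?_⟩
  exact le_sup_right.trans (hmax ⟨Subgroup.sup_normal K N, isSolvable_sup K N⟩ le_sup_left)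

/-! ### The affine group of a module -/

/-- The action of `H` on an additive group `V`, as automorphisms of `Multiplicative V`. -/
def multiplicativeAction (H V : Type*) [Group H] [AddCommGroup V] [DistribMulAction H V] :
    H →* MulAut (Multiplicative V) where
  toFun h :=
    { toFun v := .ofAdd (h • v.toAdd)
      invFun v := .ofAdd (h⁻¹ • v.toAdd)
      left_inv v := by simp
      right_inv v := by simp
      map_mul' v w := by simp }
  map_one' := by ext; simp
  map_mul' g h := by ext; simp [mul_smul]

/-- The group of pairs `(v, h)` with multiplication `(v, g) (w, h) = (v + g • w, g h)`. -/
abbrev AffineGroup (H V : Type*) [Group H] [AddCommGroup V] [DistribMulAction H V] :=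
  Multiplicative V ⋊[multiplicativeAction H V] H

namespace AffineGroup

open SemidirectProduct commutatorElement

variable {H V : Type*} [Group H] [AddCommGroup V] [DistribMulAction H V]

/-- The translation by `v`. -/
abbrev translation (v : V) : AffineGroup H V := inl (.ofAdd v)

theorem translation_pow (v : V) (n : ℕ) :
    (translation v : AffineGroup H V) ^ n = translation (n • v) := by
  rw [translation, ← map_pow, ← ofAdd_nsmul]

theorem translation_eq_one_iff {v : V} : (translation v : AffineGroup H V) = 1 ↔ v = 0 := by
  rw [← map_one inl, inl_inj, ofAdd_eq_one]

theorem right_pow (g : AffineGroup H V) (n : ℕ) : (g ^ n).right = g.right ^ n :=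
  map_pow rightHom g n

theorem left_pow (g : AffineGroup H V) (n : ℕ) :
    (g ^ n).left = .ofAdd (∑ i ∈ Finset.range n, g.right ^ i • g.left.toAdd) := by
  induction n with
  | zero => rfl
  | succ n ih =>
    rw [pow_succ, mul_left, ih, right_pow, Finset.sum_range_succ]
    rfl

theorem pow_eq_translation {g : AffineGroup H V} {n : ℕ} (h : g.right ^ n = 1) :
    g ^ n = translation (∑ i ∈ Finset.range n, g.right ^ i • g.left.toAdd) := by
  ext
  · rw [left_pow, left_inl]
  · rw [right_pow, right_inl, h]

theorem commutator_translation {z : H} (hz : ∀ v : V, z • v = -v) (v : V) :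
    (translation v * inr z * (translation v)⁻¹ * (inr z)⁻¹ : AffineGroup H V) =
      translation (2 • v) := by
  rw [mul_assoc (translation v), mul_assoc (translation v), ← map_inv inl,
    ← map_inv inr, ← inl_aut, ← map_mul]
  congr 1
  change Multiplicative.ofAdd (v + z • -v) = _
  rw [hz, neg_neg, two_nsmul]

theorem pow_two_mul_eq_one {z : H} (hz : ∀ v : V, z • v = -v) (hz2 : z ^ 2 = 1)
    {g : AffineGroup H V} {n : ℕ} (h : g.right ^ n = z) : g ^ (2 * n) = 1 := by
  rw [mul_comm, pow_mul, pow_eq_translation (by rw [right_pow, h, hz2]), translation_eq_one_iff]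
  simp [Finset.sum_range_succ, right_pow, h, hz]

theorem not_isNilpotent_of_neg {z : H} (hz : ∀ v : V, z • v = -v)
    (h2 : ∀ v : V, ∃ w, 2 • w = v) [Nontrivial V] {K : Subgroup (AffineGroup H V)}
    (hV : ∀ v : V, translation v ∈ K) (hzK : inr z ∈ K) : ¬ Group.IsNilpotent K := by
  intro hK
  obtain ⟨n, hn⟩ := Subgroup.nilpotent_iff_lowerCentralSeries.mp hK
  have key : ∀ n, ∀ v : V,
      (⟨translation v, hV v⟩ : K) ∈ (⊤ : Subgroup K).lowerCentralSeries n := by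
    intro n
    induction n with
    | zero => exact fun v => Subgroup.mem_top _
    | succ n ih =>
      intro v
      obtain ⟨w, rfl⟩ := h2 v
      rw [Subgroup.lowerCentralSeries_succ]
      have : (⟨translation (2 • w), hV _⟩ : K) =
          ⁅(⟨translation w, hV w⟩ : K), (⟨inr z, hzK⟩ : K)⁆ :=
        Subtype.ext (commutator_translation hz w).symm
      rw [this]
      exact Subgroup.commutator_mem_commutator (ih w) (Subgroup.mem_top _)
  obtain ⟨v, hv⟩ := exists_ne (0 : V)
  have := key n v
  rw [hn, Subgroup.mem_bot] at this
  exact hv (translation_eq_one_iff.mp (congrArg Subtype.val this))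

theorem isSolvable_comap_zpowers (z : H) :
    Group.IsSolvable ((Subgroup.zpowers z).comap (rightHom : AffineGroup H V →* H)) := by
  let R := (Subgroup.zpowers z).comap (rightHom : AffineGroup H V →* H)
  let f : Multiplicative V →* R := inl.codRestrict R fun v => by
    simp [R, Subgroup.mem_comap]
  let g : R →* Subgroup.zpowers z := (rightHom.comp R.subtype).codRestrict _ fun x => x.2
  have : Group.IsSolvable (Subgroup.zpowers z) :=
    Group.isSolvable_of_comm fun a b => (Subgroup.zpowers_isMulCommutative z).is_comm.comm a b
  refine Group.isSolvable_of_ker_le_range f g ?_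
  intro x hx
  have hx1 : rightHom (x : AffineGroup H V) = 1 := congrArg Subtype.val (MonoidHom.mem_ker.mp hx)
  rw [← MonoidHom.mem_ker, ← range_inl_eq_ker_rightHom] at hx1
  obtain ⟨v, hv⟩ := hx1
  exact ⟨v, Subtype.ext hv⟩

theorem exists_solvable_radical_not_isNilpotent [Finite H] [Finite V] {z : H}
    (hzc : ∀ h : H, h * z = z * h) (hz : ∀ v : V, z • v = -v)
    (h2 : ∀ v : V, ∃ w, 2 • w = v) [Nontrivial V] :
    ∃ K : Subgroup (AffineGroup H V), K.Normal ∧ Group.IsSolvable K ∧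
      (∀ N : Subgroup (AffineGroup H V), N.Normal → Group.IsSolvable N → N ≤ K) ∧
      ¬ Group.IsNilpotent K := by
  have : Finite (AffineGroup H V) := Finite.of_equiv _ equivProd.symm
  obtain ⟨K, hK, hKs, hmax⟩ := exists_normal_isSolvable_forall_le (AffineGroup H V)
  have hzn : (Subgroup.zpowers z).Normal :=
    ⟨fun x hx h => by
      obtain ⟨k, rfl⟩ := Subgroup.mem_zpowers_iff.mp hx
      have hk : Commute h (z ^ k) := Commute.zpow_right (hzc h) k
      rwa [hk.eq, mul_inv_cancel_right]⟩
  have hle := hmax _ (hzn.comap rightHom) (isSolvable_comap_zpowers (V := V) z)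
  refine ⟨K, hK, hKs, hmax, not_isNilpotent_of_neg hz h2 (fun v => hle ?_) (hle ?_)⟩
  · simp [Subgroup.mem_comap]
  · simp [Subgroup.mem_comap]

end AffineGroup

/-! ### Orders of elements and spectra with maximal elements 8, 9, 10, 12, 15 and 21 -/

theorem orderOf_eq_prime_mul_prime {G : Type*} [Monoid G] {x : G} {p q : ℕ} (hp : p.Prime)
    (hq : q.Prime) (hpq : x ^ (p * q) = 1) (hxp : x ^ p ≠ 1) (hxq : x ^ q ≠ 1) :
    orderOf x = p * q := by
  refine orderOf_eq_of_pow_and_pow_div_prime (Nat.mul_pos hp.pos hq.pos) hpq fun r hr hrpq => ?_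
  rcases (Nat.Prime.dvd_mul hr).mp hrpq with h | h
  · rw [(Nat.prime_dvd_prime_iff_eq hr hp).mp h, Nat.mul_div_cancel_left _ hp.pos]
    exact hxq
  · rw [(Nat.prime_dvd_prime_iff_eq hr hq).mp h, Nat.mul_div_cancel _ hq.pos]
    exact hxp

theorem specSet_eq_of_maximal_orders {G : Type*} [Group G]
    (h : ∀ g : G, g ^ 8 = 1 ∨ g ^ 9 = 1 ∨ g ^ 10 = 1 ∨ g ^ 12 = 1 ∨ g ^ 15 = 1 ∨ g ^ 21 = 1)
    (h' : {8, 9, 10, 12, 15, 21} ⊆ specSet G) :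
    specSet G = {n | n ∣ 8 ∨ n ∣ 9 ∨ n ∣ 10 ∨ n ∣ 12 ∨ n ∣ 15 ∨ n ∣ 21} := by
  have hdvd {m n : ℕ} (hm : m ∈ specSet G) (hm0 : m ≠ 0) (hn : n ∣ m) : n ∈ specSet G := by
    obtain ⟨g, rfl⟩ := hm
    exact ⟨g ^ (orderOf g / n), orderOf_pow_orderOf_div hm0 hn⟩
  ext n
  constructor
  · rintro ⟨g, rfl⟩
    simpa only [Set.mem_ofPred_eq, orderOf_dvd_iff_pow_eq_one] using h g
  · rintro (hn | hn | hn | hn | hn | hn) <;> exact hdvd (h' (by simp)) (by norm_num) hn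

/-! ### Odd functions -/

/-- The functions `f : H → ZMod 3` with `f (z * x) = -f x`. -/
def oddFunctions {H : Type*} [Group H] (z : H) : AddSubgroup (H → ZMod 3) where
  carrier := {f | ∀ x, f (z * x) = -f x}
  add_mem' hf hg x := by simp [hf x, hg x, add_comm]
  zero_mem' x := by simp
  neg_mem' hf x := by simp [hf x]

namespace oddFunctions

variable {H : Type*} [Group H] {z : H}

/-- `H` acts on odd functions by right translation of the argument. -/
instance : DistribMulAction H (oddFunctions z) where
  smul h f := ⟨fun x => f.1 (x * h), fun x => by
    simpa only [mul_assoc] using f.2 (x * h)⟩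
  one_smul f := Subtype.ext <| funext fun x => congrArg f.1 (mul_one x)
  mul_smul g h f := Subtype.ext <| funext fun x => congrArg f.1 (mul_assoc x g h).symm
  smul_zero _ := rfl
  smul_add _ _ _ := rfl

theorem smul_apply (h : H) (f : oddFunctions z) (x : H) : (h • f).1 x = f.1 (x * h) := rfl

theorem smul_eq_neg (hzc : ∀ h : H, h * z = z * h) (f : oddFunctions z) : z • f = -f := by
  ext x
  rw [smul_apply, hzc, f.2]
  rfl

theorem three_nsmul (f : oddFunctions z) : 3 • f = 0 := by
  ext x
  change 3 • f.1 x = 0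
  rw [nsmul_eq_mul]
  exact zero_mul _

open Classical in
theorem exists_sum_ne_zero (hz1 : z ≠ 1) (hz2 : z ^ 2 = 1) {h : H} (hh : Odd (orderOf h)) :
    ∃ f : oddFunctions z, ∑ i ∈ Finset.range (orderOf h), h ^ i • f ≠ 0 := by
  have hzz : z * z = 1 := by rw [← pow_two, hz2]
  have hinv : z⁻¹ = z := inv_eq_of_mul_eq_one_right hzz
  refine ⟨⟨fun x => if x = 1 then 1 else if x = z then -1 else 0, fun x => ?_⟩, fun h0 => ?_⟩
  · by_cases hx1 : x = 1
    · simp [hx1, hz1]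
    by_cases hxz : x = z
    · simp [hxz, hzz, hz1]
    · have : z * x ≠ 1 := fun h => hxz (by rw [← hinv, eq_inv_of_mul_eq_one_right h])
      simp [hx1, hxz, this]
  · have h1 := congrFun (congrArg Subtype.val h0) 1
    rw [AddSubgroup.val_finsetSum, Finset.sum_apply, Finset.sum_eq_single 0] at h1
    · simp at h1
    · intro i hi hi0
      have hi1 : h ^ i ≠ 1 := pow_ne_one_of_lt_orderOf hi0 (Finset.mem_range.mp hi)
      have hiz : h ^ i ≠ z := by
        intro hiz
        have h2 : h ^ (2 * i) = 1 := by rw [mul_comm, pow_mul, hiz, hz2]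
        have := (Nat.Coprime.dvd_mul_left (Nat.coprime_two_right.mpr hh)).mp
          (orderOf_dvd_of_pow_eq_one h2)
        exact hi1 (orderOf_dvd_iff_pow_eq_one.mp this)
      simp [smul_apply, hi1, hiz]
    · simp [hh.pos]

end oddFunctions

namespace AffineGroup

open SemidirectProduct

variable {H A : Type*} [Group H] [AddCommGroup A] [DistribMulAction H A] {z : H}

theorem pow_three_mul_eq_one {h : H} {n : ℕ} (hn : h ^ n = 1)
    (hA : ∀ a : A, ∑ i ∈ Finset.range n, h ^ i • a = 0)
    {g : AffineGroup H (A × oddFunctions z)} (hg : g.right = h) : g ^ (n * 3) = 1 := by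
  rw [pow_mul, pow_eq_translation (n := n) (by rw [hg, hn]), translation_pow,
    translation_eq_one_iff]
  ext1
  · rw [Prod.smul_fst, Prod.fst_sum, hg]
    simp only [Prod.smul_fst, hA, smul_zero, Prod.fst_zero]
  · exact oddFunctions.three_nsmul _

theorem exists_orderOf_three_mul (hz1 : z ≠ 1) (hz2 : z ^ 2 = 1) {h : H}
    (hh : Odd (orderOf h)) : ∃ g : AffineGroup H (A × oddFunctions z),
      g.right = h ∧ g ^ orderOf h ≠ 1 := by
  obtain ⟨f, hf⟩ := oddFunctions.exists_sum_ne_zero hz1 hz2 hh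
  refine ⟨⟨.ofAdd (0, f), h⟩, rfl, fun h1 => hf ?_⟩
  rw [pow_eq_translation (pow_orderOf_eq_one h), translation_eq_one_iff] at h1
  simpa [Prod.snd_sum] using congrArg Prod.snd h1

theorem specSet_eq [Nontrivial A] (hzc : ∀ h : H, h * z = z * h) (hz1 : z ≠ 1)
    (hz2 : z ^ 2 = 1) (hA : ∀ a : A, z • a = -a) (hA7 : ∀ a : A, 7 • a = 0)
    (hH : ∀ h : H, h = 1 ∨ (h ^ 3 = 1 ∧ ∀ a : A, ∑ i ∈ Finset.range 3, h ^ i • a = 0) ∨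
      (h ^ 5 = 1 ∧ ∀ a : A, ∑ i ∈ Finset.range 5, h ^ i • a = 0) ∨
      h ^ 3 = z ∨ h ^ 4 = z ∨ h ^ 5 = z ∨ h ^ 6 = z)
    (h8 : ∃ h : H, h ^ 4 = z) (h10 : ∃ h : H, h ^ 5 = z ∧ h ^ 2 ≠ 1)
    (h12 : ∃ h : H, h ^ 6 = z ∧ h ^ 4 ≠ 1) :
    specSet (AffineGroup H (A × oddFunctions z)) =
      {n | n ∣ 8 ∨ n ∣ 9 ∨ n ∣ 10 ∨ n ∣ 12 ∨ n ∣ 15 ∨ n ∣ 21} := by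
  have hV : ∀ v : A × oddFunctions z, z • v = -v := fun v =>
    Prod.ext (hA v.1) (oddFunctions.smul_eq_neg hzc v.2)
  obtain ⟨a, ha⟩ := h8
  obtain ⟨d, hd5, hd2⟩ := h10
  obtain ⟨b, hb6, hb4⟩ := h12
  have hinr (h : H) : orderOf (inr h : AffineGroup H (A × oddFunctions z)) = orderOf h :=
    orderOf_injective inr inr_injective h
  have ht : orderOf (b ^ 4) = 3 := by
    refine orderOf_eq_prime ?_ hb4
    rw [← pow_mul, show 4 * 3 = 6 * 2 from rfl, pow_mul, hb6, hz2]
  have hu : orderOf (d ^ 2) = 5 := by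
    have : Fact (Nat.Prime 5) := ⟨Nat.prime_five⟩
    refine orderOf_eq_prime ?_ hd2
    rw [← pow_mul, show 2 * 5 = 5 * 2 from rfl, pow_mul, hd5, hz2]
  have hz : orderOf z = 2 := orderOf_eq_prime hz2 hz1
  have hodd {h : H} (hh : Odd (orderOf h)) (n : ℕ) : h ^ n ≠ z := by
    intro hn
    have h2 := orderOf_pow_dvd (x := h) n
    rw [hn, hz] at h2
    exact Nat.not_even_iff_odd.mpr hh (even_iff_two_dvd.mpr h2)
  refine specSet_eq_of_maximal_orders (fun g => ?_) ?_
  · rcases hH g.right with h | ⟨h, h'⟩ | ⟨h, h'⟩ | h | h | h | h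
    · have : g ^ 21 = 1 := by
        have h1 := pow_eq_translation (g := g) (n := 1) (by rw [pow_one, h])
        rw [pow_one] at h1
        rw [h1, translation_pow, translation_eq_one_iff]
        ext1
        · rw [Prod.smul_fst, show 21 = 7 * 3 from rfl, mul_comm, mul_nsmul, hA7, Prod.fst_zero]
        · rw [Prod.smul_snd, show 21 = 3 * 7 from rfl, mul_nsmul, oddFunctions.three_nsmul,
            smul_zero, Prod.snd_zero]
      simp [this]
    · simp [pow_three_mul_eq_one h h' rfl]
    · simp [pow_three_mul_eq_one h h' rfl]
    · have : g ^ (2 * 3) = 1 := pow_two_mul_eq_one hV hz2 h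
      have : g ^ 12 = 1 := by rw [show 12 = 2 * 3 * 2 from rfl, pow_mul, this, one_pow]
      simp [this]
    · simp [pow_two_mul_eq_one hV hz2 h]
    · simp [pow_two_mul_eq_one hV hz2 h]
    · simp [pow_two_mul_eq_one hV hz2 h]
  · rintro n (rfl | rfl | rfl | rfl | rfl | rfl)
    · refine ⟨inr a, (hinr a).trans (orderOf_eq_prime_pow (p := 2) (n := 2) ?_ ?_)⟩
      · norm_num [ha, hz1]
      · rw [show 2 ^ (2 + 1) = 4 * 2 from rfl, pow_mul, ha, hz2]
    · have hb : Odd (orderOf (b ^ 4)) := by rw [ht]; decide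
      obtain ⟨g, hg, hg3⟩ := exists_orderOf_three_mul (A := A) hz1 hz2 hb
      rw [ht] at hg3
      refine ⟨g, orderOf_eq_prime_pow (p := 3) (n := 1) (by simpa using hg3) ?_⟩
      rcases hH (b ^ 4) with h | ⟨h, h'⟩ | ⟨h, -⟩ | h | h | h | h
      · exact absurd h hb4
      · exact pow_three_mul_eq_one h h' hg
      · rw [← orderOf_dvd_iff_pow_eq_one, ht] at h
        norm_num at h
      all_goals exact absurd h (hodd hb _)
    · refine ⟨inr d, (hinr d).trans (orderOf_eq_prime_mul_prime Nat.prime_two Nat.prime_five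
        ?_ hd2 (hd5.trans_ne hz1))⟩
      rw [mul_comm, pow_mul, hd5, hz2]
    · refine ⟨inr b, (hinr b).trans (orderOf_eq_of_pow_and_pow_div_prime (by norm_num) ?_ ?_)⟩
      · rw [show 12 = 6 * 2 from rfl, pow_mul, hb6, hz2]
      · intro p hp hp12
        rw [show 12 = 2 * (2 * 3) from rfl, hp.dvd_mul, hp.dvd_mul,
          Nat.prime_dvd_prime_iff_eq hp Nat.prime_two,
          Nat.prime_dvd_prime_iff_eq hp Nat.prime_three] at hp12
        rcases hp12 with rfl | rfl | rfl
        · exact hb6.trans_ne hz1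
        · exact hb6.trans_ne hz1
        · exact hb4
    · have hd : Odd (orderOf (d ^ 2)) := by rw [hu]; decide
      obtain ⟨g, hg, hg5⟩ := exists_orderOf_three_mul (A := A) hz1 hz2 hd
      rw [hu] at hg5
      refine ⟨g, orderOf_eq_prime_mul_prime Nat.prime_five Nat.prime_three ?_ hg5 fun hg3 => ?_⟩
      · rcases hH (d ^ 2) with h | ⟨h, -⟩ | ⟨h, h'⟩ | h | h | h | h
        · exact absurd h hd2
        · rw [← orderOf_dvd_iff_pow_eq_one, hu] at h
          norm_num at h
        · exact pow_three_mul_eq_one h h' hg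
        all_goals exact absurd h (hodd hd _)
      · have h := right_pow g 3
        rw [hg3, one_right, hg, eq_comm, ← orderOf_dvd_iff_pow_eq_one, hu] at h
        norm_num at h
    · obtain ⟨f, hf⟩ := oddFunctions.exists_sum_ne_zero hz1 hz2 (h := 1) (by simp)
      have hf0 : f ≠ 0 := by simpa using hf
      obtain ⟨x, hx⟩ := exists_ne (0 : A)
      refine ⟨translation (x, f), orderOf_eq_prime_mul_prime Nat.prime_three
        (by norm_num : Nat.Prime 7) ?_ ?_ ?_⟩
      · rw [translation_pow, translation_eq_one_iff]
        ext1
        · rw [Prod.smul_fst, mul_comm, mul_nsmul, hA7, smul_zero, Prod.fst_zero]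
        · rw [Prod.smul_snd, mul_nsmul, oddFunctions.three_nsmul, smul_zero, Prod.snd_zero]
      · rw [translation_pow, Ne, translation_eq_one_iff]
        intro h
        have h3 : 3 • x = 0 := congrArg Prod.fst h
        refine hx ?_
        rw [show x = 7 • x - 2 • (3 • x) by abel, hA7, h3, smul_zero, sub_zero]
      · rw [translation_pow, Ne, translation_eq_one_iff]
        intro h
        have h7 : 7 • f = 0 := congrArg Prod.snd h
        refine hf0 ?_
        rw [show f = 7 • f - 2 • (3 • f) by abel, oddFunctions.three_nsmul, h7, smul_zero, sub_zero]

end AffineGroup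

/-! ### The spectrum of the alternating group of degree 10 -/

theorem Nat.Partition.lcm_dvd_of_even_card (p : Nat.Partition 10) (hp : Even p.parts.card) :
    p.parts.lcm ∣ 8 ∨ p.parts.lcm ∣ 9 ∨ p.parts.lcm ∣ 10 ∨ p.parts.lcm ∣ 12 ∨
      p.parts.lcm ∣ 15 ∨ p.parts.lcm ∣ 21 := by
  have hmem : ∀ k ∈ p.parts, k ∈ Finset.Icc 1 10 := fun k hk =>
    Finset.mem_Icc.mpr ⟨p.parts_pos hk, p.parts_sum ▸ Multiset.le_sum_of_mem hk⟩
  have hsum : ∑ k ∈ Finset.Icc 1 10, p.parts.count k * k = 10 := by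
    have := Finset.sum_multiset_count_of_subset p.parts (Finset.Icc 1 10)
      fun k hk => hmem k (Multiset.mem_toFinset.mp hk)
    rw [p.parts_sum] at this
    exact this.symm
  have hcard := Multiset.sum_count_eq_card hmem
  have hdvd {n : ℕ} (hn : ∀ k ∈ Finset.Icc 1 10, p.parts.count k = 0 ∨ k ∣ n) :
      p.parts.lcm ∣ n :=
    Multiset.lcm_dvd.mpr fun k hk =>
      (hn k (hmem k hk)).resolve_left (Multiset.count_ne_zero.mpr hk)
  have h8 := hdvd (n := 8)
  have h9 := hdvd (n := 9)
  have h10 := hdvd (n := 10)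
  have h12 := hdvd (n := 12)
  have h15 := hdvd (n := 15)
  have h21 := hdvd (n := 21)
  obtain ⟨r, hr⟩ := hp
  rw [hr] at hcard
  simp only [show Finset.Icc 1 10 = {1, 2, 3, 4, 5, 6, 7, 8, 9, 10} by decide,
    Finset.forall_mem_insert, Finset.mem_singleton, forall_eq] at h8 h9 h10 h12 h15 h21
  norm_num at h8 h9 h10 h12 h15 h21
  simp only [← Multiset.count_eq_zero] at h8 h9 h10 h12 h15 h21
  norm_num [show Finset.Icc 1 10 = {1, 2, 3, 4, 5, 6, 7, 8, 9, 10} by decide] at hsum hcard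
  generalize p.parts.count 1 = c1 at *
  generalize p.parts.count 2 = c2 at *
  generalize p.parts.count 3 = c3 at *
  generalize p.parts.count 4 = c4 at *
  generalize p.parts.count 5 = c5 at *
  generalize p.parts.count 6 = c6 at *
  generalize p.parts.count 7 = c7 at *
  generalize p.parts.count 8 = c8 at *
  generalize p.parts.count 9 = c9 at *
  generalize p.parts.count 10 = c10 at *
  have key : (c3 = 0 ∧ c5 = 0 ∧ c6 = 0 ∧ c7 = 0 ∧ c9 = 0 ∧ c10 = 0) ∨
      (c2 = 0 ∧ c4 = 0 ∧ c5 = 0 ∧ c6 = 0 ∧ c7 = 0 ∧ c8 = 0 ∧ c10 = 0) ∨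
      (c3 = 0 ∧ c4 = 0 ∧ c6 = 0 ∧ c7 = 0 ∧ c8 = 0 ∧ c9 = 0) ∨
      (c5 = 0 ∧ c7 = 0 ∧ c8 = 0 ∧ c9 = 0 ∧ c10 = 0) ∨
      (c2 = 0 ∧ c4 = 0 ∧ c6 = 0 ∧ c7 = 0 ∧ c8 = 0 ∧ c9 = 0 ∧ c10 = 0) ∨
      (c2 = 0 ∧ c4 = 0 ∧ c5 = 0 ∧ c6 = 0 ∧ c8 = 0 ∧ c9 = 0 ∧ c10 = 0) := by
    clear h8 h9 h10 h12 h15 h21 hmem hdvd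
    have h10 : c10 = 0 := by omega
    obtain h9 | h9 := Nat.eq_zero_or_pos c9
    · obtain h8 | h8 := Nat.eq_zero_or_pos c8
      · obtain h7 | h7 := Nat.eq_zero_or_pos c7
        · obtain h5 | h5 := Nat.eq_zero_or_pos c5
          · simp [*]
          · have h6 : c6 = 0 := by omega
            obtain h3 | h3 := Nat.eq_zero_or_pos c3
            · have h4 : c4 = 0 := by
                by_contra h4
                have h4' : c4 = 1 := by omega
                have h5' : c5 = 1 := by omega
                omega
              simp [*]
            · have h2 : c2 = 0 := by omega
              have h4 : c4 = 0 := by omega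
              simp [*]
        · have h : c2 = 0 ∧ c4 = 0 ∧ c5 = 0 ∧ c6 = 0 := by omega
          simp [*]
      · have h : c3 = 0 ∧ c5 = 0 ∧ c6 = 0 ∧ c7 = 0 := by omega
        simp [*]
    · have h : c2 = 0 ∧ c4 = 0 ∧ c5 = 0 ∧ c6 = 0 ∧ c7 = 0 ∧ c8 = 0 := by omega
      simp [*]
  exact key.imp (fun ⟨a, b, c, d, e, f⟩ => h8 a b c d e f) <|
    .imp (fun ⟨a, b, c, d, e, f, g⟩ => h9 a b c d e f g) <|
    .imp (fun ⟨a, b, c, d, e, f⟩ => h10 a b c d e f) <|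
    .imp (fun ⟨a, b, c, d, e⟩ => h12 a b c d e) <|
    .imp (fun ⟨a, b, c, d, e, f, g⟩ => h15 a b c d e f g)
    fun ⟨a, b, c, d, e, f, g⟩ => h21 a b c d e f g

theorem specSet_alternatingGroup_ten :
    specSet (alternatingGroup (Fin 10)) =
      {n | n ∣ 8 ∨ n ∣ 9 ∨ n ∣ 10 ∨ n ∣ 12 ∨ n ∣ 15 ∨ n ∣ 21} := by
  have hspec (σ : Equiv.Perm (Fin 10)) (hσ : Equiv.Perm.sign σ = 1) {n : ℕ} (hn : 0 < n)
      (hpow : σ ^ n = 1) (hlt : ∀ m < n, 0 < m → σ ^ m ≠ 1) :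
      n ∈ specSet (alternatingGroup (Fin 10)) :=
    ⟨⟨σ, hσ⟩, by rw [← Subgroup.orderOf_coe]; exact (orderOf_eq_iff hn).mpr ⟨hpow, hlt⟩⟩
  refine specSet_eq_of_maximal_orders (fun g => ?_) ?_
  · have hg : Equiv.Perm.sign (g : Equiv.Perm (Fin 10)) = 1 := g.2
    have hlcm : (g : Equiv.Perm (Fin 10)).partition.parts.lcm = orderOf g := by
      rw [Equiv.Perm.parts_partition, Multiset.lcm_add, Equiv.Perm.lcm_cycleType,
        Subgroup.orderOf_coe]
      exact Nat.dvd_antisymm (Nat.lcm_dvd dvd_rfl (Multiset.lcm_dvd.mpr fun k hk => by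
        simp [Multiset.eq_of_mem_replicate hk])) (Nat.dvd_lcm_left _ _)
    have hcard : Even (g : Equiv.Perm (Fin 10)).partition.parts.card := by
      have hs := Equiv.Perm.sum_cycleType (g : Equiv.Perm (Fin 10))
      have hle := Finset.card_le_univ (g : Equiv.Perm (Fin 10)).support
      rw [Equiv.Perm.sign_of_cycleType, neg_one_pow_eq_one_iff_even (by decide)] at hg
      rw [Equiv.Perm.parts_partition, Multiset.card_add, Multiset.card_replicate]
      simp only [Fintype.card_fin] at hle ⊢
      rw [Nat.even_iff] at *
      omega
    simpa only [hlcm, orderOf_dvd_iff_pow_eq_one] using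
      (g : Equiv.Perm (Fin 10)).partition.lcm_dvd_of_even_card hcard
  · rintro n (rfl | rfl | rfl | rfl | rfl | rfl)
    · exact hspec (c[0, 1, 2, 3, 4, 5, 6, 7] * c[8, 9]) (by decide +kernel) (by norm_num)
        (by decide +kernel) (by decide +kernel)
    · exact hspec c[0, 1, 2, 3, 4, 5, 6, 7, 8] (by decide +kernel) (by norm_num)
        (by decide +kernel) (by decide +kernel)
    · exact hspec (c[0, 1, 2, 3, 4] * c[5, 6] * c[7, 8]) (by decide +kernel) (by norm_num)
        (by decide +kernel) (by decide +kernel)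
    · exact hspec (c[0, 1, 2, 3] * c[4, 5, 6] * c[7, 8]) (by decide +kernel) (by norm_num)
        (by decide +kernel) (by decide +kernel)
    · exact hspec (c[0, 1, 2, 3, 4] * c[5, 6, 7]) (by decide +kernel) (by norm_num)
        (by decide +kernel) (by decide +kernel)
    · exact hspec (c[0, 1, 2, 3, 4, 5, 6] * c[7, 8, 9]) (by decide +kernel) (by norm_num)
        (by decide +kernel) (by decide +kernel)

/-! ### Matrices over `ZMod 7` encoded by natural numbers -/

/-- The `k`-th octal digit of `c`. -/
def octalDigit (c k : ℕ) : ℕ := c / 8 ^ k % 8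

/-- The matrix over `ZMod 7` whose entries are the octal digits of `c`, in row-major order. -/
def matrixOfCode (c : ℕ) : Matrix (Fin 4) (Fin 4) (ZMod 7) :=
  Matrix.of fun i j => (octalDigit c (4 * i + j) : ZMod 7)

/-- A code of the matrix with entries `f i j`. -/
def encodeMatrix (f : ℕ → ℕ → ℕ) : ℕ :=
  f 0 0 % 7 + f 0 1 % 7 * 8 + f 0 2 % 7 * 8 ^ 2 + f 0 3 % 7 * 8 ^ 3 +
  f 1 0 % 7 * 8 ^ 4 + f 1 1 % 7 * 8 ^ 5 + f 1 2 % 7 * 8 ^ 6 + f 1 3 % 7 * 8 ^ 7 +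
  f 2 0 % 7 * 8 ^ 8 + f 2 1 % 7 * 8 ^ 9 + f 2 2 % 7 * 8 ^ 10 + f 2 3 % 7 * 8 ^ 11 +
  f 3 0 % 7 * 8 ^ 12 + f 3 1 % 7 * 8 ^ 13 + f 3 2 % 7 * 8 ^ 14 + f 3 3 % 7 * 8 ^ 15

/-- A code of the product of two encoded matrices. -/
def codeMul (c d : ℕ) : ℕ :=
  encodeMatrix fun i j =>
    octalDigit c (4 * i) * octalDigit d j + octalDigit c (4 * i + 1) * octalDigit d (4 + j) +
    octalDigit c (4 * i + 2) * octalDigit d (8 + j) +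
    octalDigit c (4 * i + 3) * octalDigit d (12 + j)

/-- A code of the sum of the identity and an encoded matrix. -/
def codeSucc (c : ℕ) : ℕ :=
  encodeMatrix fun i j => octalDigit c (4 * i + j) + if i = j then 1 else 0

/-- The canonical code of the identity matrix. -/
def codeOne : ℕ := encodeMatrix fun i j => if i = j then 1 else 0

/-- The canonical code of the negative of the identity matrix. -/
def codeNegOne : ℕ := encodeMatrix fun i j => if i = j then 6 else 0

/-- A code of a power of an encoded matrix. -/
def codePow (c : ℕ) : ℕ → ℕ
  | 0 => codeOne
  | n + 1 => codeMul (codePow c n) c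

theorem matrixOfCode_encodeMatrix (f : ℕ → ℕ → ℕ) :
    matrixOfCode (encodeMatrix f) = Matrix.of fun i j : Fin 4 => (f i j : ZMod 7) := by
  ext i j
  have key : octalDigit (encodeMatrix f) (4 * i + j) = f i j % 7 := by
    unfold octalDigit encodeMatrix
    fin_cases i <;> fin_cases j <;> simp <;> omega
  simp [matrixOfCode, key]

theorem matrixOfCode_codeMul (c d : ℕ) :
    matrixOfCode (codeMul c d) = matrixOfCode c * matrixOfCode d := by
  rw [codeMul, matrixOfCode_encodeMatrix]
  ext i j
  simp [Matrix.mul_apply, Fin.sum_univ_four, matrixOfCode]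

theorem matrixOfCode_codeOne : matrixOfCode codeOne = 1 := by
  rw [codeOne, matrixOfCode_encodeMatrix]
  ext i j
  simp [Matrix.one_apply, Fin.ext_iff]

theorem matrixOfCode_codeNegOne : matrixOfCode codeNegOne = -1 := by
  rw [codeNegOne, matrixOfCode_encodeMatrix]
  ext i j
  fin_cases i <;> fin_cases j <;> rfl

theorem matrixOfCode_codeSucc (c : ℕ) :
    matrixOfCode (codeSucc c) = matrixOfCode c + 1 := by
  rw [codeSucc, matrixOfCode_encodeMatrix]
  ext i j
  simp [Matrix.one_apply, Fin.ext_iff, matrixOfCode]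

theorem matrixOfCode_codePow (c n : ℕ) : matrixOfCode (codePow c n) = matrixOfCode c ^ n := by
  induction n with
  | zero => simp [codePow, matrixOfCode_codeOne]
  | succ n ih => rw [codePow, matrixOfCode_codeMul, ih, pow_succ]

/-- Code of an element of order `8`. -/
def genA : ℕ := 184766271934482

/-- Code of an element of order `12`. -/
def genB : ℕ := 185010415031848

/-- Code of the element `b²aba²` of order `5`. -/
def genU : ℕ :=
  codeMul (codeMul (codePow genB 2) genA) (codeMul genB (codePow genA 2))

/-- Codes of the elements `uⁱ aʲ bᵏ` of the group generated by `a` and `b`. -/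
def groupCodes : List ℕ :=
  (List.range 5).flatMap fun i => (List.range 8).flatMap fun j => (List.range 6).map fun k =>
    codeMul (codeMul (codePow genU i) (codePow genA j)) (codePow genB k)

theorem codeMul_mem_groupCodes :
    ∀ c ∈ groupCodes, codeMul c genA ∈ groupCodes ∧ codeMul c genB ∈ groupCodes := by
  decide +kernel

theorem groupCodes_cyclotomic : ∀ c ∈ groupCodes,
    c = codeOne ∨ codeMul c (codeSucc c) = codeNegOne ∨
    codeMul (codeMul c (codeSucc c)) (codeSucc (codeMul c c)) = codeNegOne ∨
    codePow c 3 = codeNegOne ∨ codePow c 4 = codeNegOne ∨ codePow c 5 = codeNegOne ∨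
    codePow c 6 = codeNegOne := by
  decide +kernel

/-! ### A double cover of the symmetric group of degree 5 -/

open commutatorElement in
theorem eq_conj_commutator {G : Type*} [Group G] {x z w : G} (h : x * z * w * x = z * x * w) :
    x = z * ⁅x, w⁆ * z⁻¹ := by
  rw [commutatorElement_def, ← mul_assoc, ← mul_assoc, ← mul_assoc, ← h]
  group

theorem matrixOfCode_genA_pow_four : matrixOfCode genA ^ 4 = -1 := by
  rw [← matrixOfCode_codePow, show codePow genA 4 = codeNegOne by decide +kernel,
    matrixOfCode_codeNegOne]

theorem matrixOfCode_genB_pow_six : matrixOfCode genB ^ 6 = -1 := by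
  rw [← matrixOfCode_codePow, show codePow genB 6 = codeNegOne by decide +kernel,
    matrixOfCode_codeNegOne]

/-- The invertible matrix with code `genA`. -/
noncomputable def unitA : (Matrix (Fin 4) (Fin 4) (ZMod 7))ˣ :=
  .ofPowEqOne (matrixOfCode genA) 8
    (by rw [show 8 = 4 * 2 from rfl, pow_mul, matrixOfCode_genA_pow_four, neg_one_sq])
    (by norm_num)

/-- The invertible matrix with code `genB`. -/
noncomputable def unitB : (Matrix (Fin 4) (Fin 4) (ZMod 7))ˣ :=
  .ofPowEqOne (matrixOfCode genB) 12
    (by rw [show 12 = 6 * 2 from rfl, pow_mul, matrixOfCode_genB_pow_six, neg_one_sq])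
    (by norm_num)

theorem val_unitA : (unitA : Matrix (Fin 4) (Fin 4) (ZMod 7)) = matrixOfCode genA := rfl

theorem val_unitB : (unitB : Matrix (Fin 4) (Fin 4) (ZMod 7)) = matrixOfCode genB := rfl

theorem unitA_pow_four : unitA ^ 4 = -1 := Units.ext <| by
  rw [Units.val_pow_eq_pow_val, val_unitA, matrixOfCode_genA_pow_four]
  rfl

/-- A double cover of the symmetric group of degree `5`, in which `-1` is the only involution. -/
def doubleCover : Subgroup (Matrix (Fin 4) (Fin 4) (ZMod 7))ˣ := .closure {unitA, unitB}

namespace doubleCover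

/-- The element `unitA` of the double cover. -/
noncomputable def a : doubleCover := ⟨unitA, Subgroup.subset_closure (by simp)⟩

/-- The element `unitB` of the double cover. -/
noncomputable def b : doubleCover := ⟨unitB, Subgroup.subset_closure (by simp)⟩

/-- The central involution of the double cover. -/
noncomputable def negOne : doubleCover := ⟨-1, unitA_pow_four ▸ pow_mem a.2 4⟩

/-- The underlying matrix of an element of the double cover. -/
def toMatrix : doubleCover →* Matrix (Fin 4) (Fin 4) (ZMod 7) :=
  (Units.coeHom _).comp doubleCover.subtype

theorem toMatrix_injective : Function.Injective toMatrix :=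
  Units.val_injective.comp Subtype.val_injective

theorem toMatrix_a : toMatrix a = matrixOfCode genA := rfl

theorem toMatrix_b : toMatrix b = matrixOfCode genB := rfl

theorem toMatrix_negOne : toMatrix negOne = -1 := rfl

theorem smul_eq_toMatrix_mul (h : doubleCover) (m : Matrix (Fin 4) (Fin 4) (ZMod 7)) :
    h • m = toMatrix h * m := rfl

theorem exists_code (h : doubleCover) : ∃ c ∈ groupCodes, matrixOfCode c = toMatrix h := by
  obtain ⟨h, hh⟩ := h
  change ∃ c ∈ groupCodes, matrixOfCode c = h
  rw [doubleCover, ← Subgroup.mem_toSubmonoid, Subgroup.closure_toSubmonoid_of_finite] at hh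
  induction hh using Submonoid.closure_induction_right with
  | one => exact ⟨codeOne, by decide +kernel, matrixOfCode_codeOne⟩
  | mul_right x hx y hy ih =>
    obtain ⟨c, hc, hcx⟩ := ih
    obtain rfl | rfl := hy
    · exact ⟨_, (codeMul_mem_groupCodes c hc).1, by
        rw [matrixOfCode_codeMul, hcx, Units.val_mul, val_unitA]⟩
    · exact ⟨_, (codeMul_mem_groupCodes c hc).2, by
        rw [matrixOfCode_codeMul, hcx, Units.val_mul, val_unitB]⟩

theorem negOne_central (h : doubleCover) : h * negOne = negOne * h :=
  toMatrix_injective <| by rw [map_mul, map_mul, toMatrix_negOne, mul_neg_one, neg_one_mul]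

theorem negOne_ne_one : negOne ≠ 1 := fun h => by
  have h1 := congrFun (congrFun (congrArg toMatrix h) 0) 0
  rw [toMatrix_negOne, map_one] at h1
  exact absurd h1 (by decide)

theorem negOne_sq : negOne ^ 2 = 1 :=
  toMatrix_injective <| by rw [map_pow, toMatrix_negOne, neg_one_sq, map_one]

theorem cyclotomic (h : doubleCover) :
    h = 1 ∨
    (h ^ 3 = 1 ∧
      ∀ m : Matrix (Fin 4) (Fin 4) (ZMod 7), ∑ i ∈ Finset.range 3, h ^ i • m = 0) ∨
    (h ^ 5 = 1 ∧
      ∀ m : Matrix (Fin 4) (Fin 4) (ZMod 7), ∑ i ∈ Finset.range 5, h ^ i • m = 0) ∨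
    h ^ 3 = negOne ∨ h ^ 4 = negOne ∨ h ^ 5 = negOne ∨ h ^ 6 = negOne := by
  obtain ⟨c, hc, hch⟩ := exists_code h
  have hpow {n : ℕ} (hn : codePow c n = codeNegOne) : h ^ n = negOne :=
    toMatrix_injective <| by
      rw [map_pow, ← hch, ← matrixOfCode_codePow, hn, matrixOfCode_codeNegOne, toMatrix_negOne]
  have hsum {n : ℕ} (hn : ∑ i ∈ Finset.range n, toMatrix h ^ i = 0) :
      h ^ n = 1 ∧
        ∀ m : Matrix (Fin 4) (Fin 4) (ZMod 7), ∑ i ∈ Finset.range n, h ^ i • m = 0 := by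
    refine ⟨toMatrix_injective ?_, fun m => ?_⟩
    · rw [map_pow, map_one, ← sub_eq_zero, ← geom_sum_mul, hn, zero_mul]
    · simp_rw [smul_eq_toMatrix_mul, map_pow]
      rw [← Finset.sum_mul, hn, zero_mul]
  rcases groupCodes_cyclotomic c hc with h1 | h3 | h5 | h' | h' | h' | h'
  · left
    apply toMatrix_injective
    rw [← hch, h1, matrixOfCode_codeOne, map_one]
  · right; left
    apply hsum
    have := congrArg matrixOfCode h3
    rw [matrixOfCode_codeMul, matrixOfCode_codeSucc, matrixOfCode_codeNegOne, hch] at this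
    rw [eq_neg_iff_add_eq_zero] at this
    rw [← this]
    simp only [Finset.sum_range_succ, Finset.sum_range_zero]
    noncomm_ring
  · right; right; left
    apply hsum
    have := congrArg matrixOfCode h5
    rw [matrixOfCode_codeMul, matrixOfCode_codeMul, matrixOfCode_codeSucc, matrixOfCode_codeSucc,
      matrixOfCode_codeMul, matrixOfCode_codeNegOne, hch] at this
    rw [eq_neg_iff_add_eq_zero] at this
    rw [← this]
    simp only [Finset.sum_range_succ, Finset.sum_range_zero]
    noncomm_ring
  all_goals simp [hpow h']

theorem a_pow_four : a ^ 4 = negOne := Subtype.ext unitA_pow_four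

theorem b_pow_six : b ^ 6 = negOne :=
  toMatrix_injective <| by rw [map_pow, toMatrix_b, matrixOfCode_genB_pow_six, toMatrix_negOne]

theorem ab_pow_five : (a * b) ^ 5 = negOne :=
  toMatrix_injective <| by
    rw [map_pow, map_mul, toMatrix_a, toMatrix_b, ← matrixOfCode_codeMul, ← matrixOfCode_codePow,
      show codePow (codeMul genA genB) 5 = codeNegOne by decide +kernel, matrixOfCode_codeNegOne,
      toMatrix_negOne]

theorem b_pow_four_ne_one : b ^ 4 ≠ 1 := fun h => by
  have h1 := congrArg toMatrix h
  rw [map_pow, map_one, toMatrix_b, ← matrixOfCode_codePow] at h1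
  exact absurd h1 (by decide +kernel)

theorem ab_sq_ne_one : (a * b) ^ 2 ≠ 1 := fun h => by
  have h1 := congrArg toMatrix h
  rw [map_pow, map_one, map_mul, toMatrix_a, toMatrix_b, ← matrixOfCode_codeMul,
    ← matrixOfCode_codePow] at h1
  exact absurd h1 (by decide +kernel)

open commutatorElement in
theorem b_sq_eq_conj_commutator :
    b ^ 2 = (a * b * a * b * a) * ⁅b ^ 2, a * b ^ 2 * a⁻¹⁆ * (a * b * a * b * a)⁻¹ := by
  have ha : a⁻¹ = a ^ 7 := by
    rw [inv_eq_iff_mul_eq_one, ← pow_succ', show 7 + 1 = 4 * 2 from rfl, pow_mul, a_pow_four,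
      negOne_sq]
  apply eq_conj_commutator
  rw [ha]
  apply toMatrix_injective
  simp only [map_mul, map_pow, toMatrix_a, toMatrix_b, ← matrixOfCode_codeMul,
    ← matrixOfCode_codePow]
  exact congrArg matrixOfCode (by decide +kernel)

theorem not_isSolvable : ¬ Group.IsSolvable doubleCover := by
  have hb : b ^ 2 ≠ 1 := fun h => b_pow_four_ne_one <|
    (pow_mul b 2 2).trans (by rw [h, one_pow])
  refine not_isSolvable_of_mem_derivedSeries hb fun n => ?_
  induction n with
  | zero => exact Subgroup.mem_top _
  | succ n ih =>
    rw [b_sq_eq_conj_commutator]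
    refine (derivedSeries_normal _ _).conj_mem _ ?_ _
    exact Subgroup.commutator_mem_commutator ih ((derivedSeries_normal _ _).conj_mem _ ih _)

end doubleCover

theorem exists_isospectral_A10_nonnilpotent_radical :
    ∃ (G : Type) (_ : Group G) (_ : Finite G), ¬ IsSolvable G ∧
      specSet G = specSet (alternatingGroup (Fin 10)) ∧
      ∃ K : Subgroup G, K.Normal ∧ IsSolvable K ∧
        (∀ N : Subgroup G, N.Normal → IsSolvable N → N ≤ K) ∧
        ¬ Group.IsNilpotent K := by
  let A := Matrix (Fin 4) (Fin 4) (ZMod 7)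
  let V := A × oddFunctions doubleCover.negOne
  have : Nontrivial (ZMod 7) := ZMod.nontrivial_iff.mpr (by norm_num)
  have : Nontrivial A := inferInstanceAs (Nontrivial (Matrix (Fin 4) (Fin 4) (ZMod 7)))
  have : Nontrivial V := inferInstanceAs (Nontrivial (A × oddFunctions doubleCover.negOne))
  have hneg (m : A) : doubleCover.negOne • m = -m := by
    rw [doubleCover.smul_eq_toMatrix_mul, doubleCover.toMatrix_negOne, neg_one_mul]
  have h7 (m : A) : 7 • m = 0 := by
    ext i j
    rw [Matrix.smul_apply, nsmul_eq_mul]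
    exact zero_mul _
  have hV (v : V) : doubleCover.negOne • v = -v :=
    Prod.ext (hneg v.1) (oddFunctions.smul_eq_neg doubleCover.negOne_central v.2)
  have h2 (v : V) : ∃ w, 2 • w = v := by
    refine ⟨11 • v, ?_⟩
    have h21 : 21 • v = 0 := Prod.ext
      (by rw [Prod.smul_fst, show 21 = 7 * 3 from rfl, mul_nsmul, h7, smul_zero, Prod.fst_zero])
      (by rw [Prod.smul_snd, show 21 = 3 * 7 from rfl, mul_nsmul, oddFunctions.three_nsmul,
            smul_zero, Prod.snd_zero])
    rw [show 2 • 11 • v = 21 • v + v by abel, h21, zero_add]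
  refine ⟨AffineGroup doubleCover V, inferInstance,
    Finite.of_equiv _ SemidirectProduct.equivProd.symm, fun hs => ?_, ?_, ?_⟩
  · have : Group.IsSolvable (AffineGroup doubleCover V) := hs
    exact doubleCover.not_isSolvable
      (Group.isSolvable_of_surjective (G := AffineGroup doubleCover V)
        SemidirectProduct.rightHom_surjective)
  · rw [specSet_alternatingGroup_ten]
    exact AffineGroup.specSet_eq doubleCover.negOne_central doubleCover.negOne_ne_one
      doubleCover.negOne_sq hneg h7 doubleCover.cyclotomic ⟨_, doubleCover.a_pow_four⟩
      ⟨_, doubleCover.ab_pow_five, doubleCover.ab_sq_ne_one⟩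
      ⟨_, doubleCover.b_pow_six, doubleCover.b_pow_four_ne_one⟩
  · exact AffineGroup.exists_solvable_radical_not_isNilpotent doubleCover.negOne_central hV h2
end
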